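/- Let p ≥ 4, 1 ≤ a ≤ p−2 and 1 ≤ b ≤ p−1 be integers with b + a + δ_{a,1} even. For every real q with 0 < q < 1, Fer^{p,0}_{a,b}(q) = q^{φ(a,b)} χ^{p,p+1}_{a,b+1}(q), where φ(a,b) = (b−a)(b−a+1)/4 and Fer^{p,0}_{a,b}(q) = Σ_{m} q^{(m·C̃m)/4 − (A^0_{a,b}·m)/2} (1/(q)_{m_0}) ∏_{j=1}^{p−2} [ (½Ĩm + ½u^0_{a,b})_j choose m_j ]_q, the sum over all m ∈ ℤ^{p−1} with nonnegative entries and m_{p−2} ≡ d (mod 2), with d = 0 if b ≠ p−1 and d = 1 if b = p−1; both sides converge absolutely. -/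

import Mathlib

open Finset

noncomputable section

/-- `(q)_k = ∏_{j=1}^k (1 - q^j)`. -/
def qPoch (q : ℝ) (k : ℕ) : ℝ := ∏ j ∈ Finset.range k, (1 - q ^ (j + 1))

/-- The Andrews–Baxter `q`-trinomial coefficient `T^n(L,A)`. -/
def qTri (q : ℝ) (n : ℤ) (L : ℕ) (A : ℤ) : ℝ :=
  if |A| ≤ (L : ℤ) then
    ∑ j ∈ Finset.range (L + 1),
      if 0 ≤ (j : ℤ) + A ∧ 0 ≤ (L : ℤ) - 2 * j - A then
        q ^ ((j : ℤ) * ((j : ℤ) + A - n)) * qPoch q L /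
          (qPoch q j * qPoch q (((j : ℤ) + A).toNat) * qPoch q (((L : ℤ) - 2 * j - A).toNat))
      else 0
  else 0

/-- Bosonic polynomial `B^p_{a,b}(L,s)`. -/
def Bpoly (q : ℝ) (p a b s : ℤ) (L : ℕ) : ℝ :=
  ∑' j : ℤ,
    (q ^ (p * (p + 1) * j ^ 2 + j * ((p + 1) * a - p * s)) * qTri q 0 L (2 * p * j + a - b)
      - q ^ ((p * j + a) * ((p + 1) * j + s)) * qTri q 0 L (2 * p * j + a + b))

/-- Bosonic polynomial `B̃^p_{a,b}(L,s)`. -/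
def Btpoly (q : ℝ) (p a b s : ℤ) (L : ℕ) : ℝ :=
  ∑' j : ℤ,
    (q ^ (p * (p + 1) * j ^ 2 + j * ((p + 1) * a - p * s)) * qTri q 1 L (2 * p * j + a - b)
      - q ^ (p * (p + 1) * j ^ 2 + j * ((p + 1) * a + p * (s - 2)) + a * (s - 1) - b)
        * qTri q 1 L (2 * p * j + a + b))

/-- `(q)_∞`. -/
def qPochInf (q : ℝ) : ℝ := ∏' j : ℕ, (1 - q ^ (j + 1))

/-- The matrix `Ĩ_{p-1}`. -/
def ItM (p : ℕ) (i j : Fin (p - 1)) : ℚ :=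
  if i.val = 0 then (if j.val = 2 then -1 else 0)
  else if j.val = 0 then (if i.val = 2 then 1 else 0)
  else if i.val = j.val + 1 ∨ j.val = i.val + 1 then 1 else 0

/-- The matrix `C̃_{p-1} = 2·Id - Ĩ_{p-1}`. -/
def CtM (p : ℕ) (i j : Fin (p - 1)) : ℚ := (if i = j then 2 else 0) - ItM p i j

/-- Unit vector `e_c` (zero if `c` is out of range). -/
def evec (p c : ℕ) : Fin (p - 1) → ℚ := fun i => if i.val = c then 1 else 0

/-- Kronecker delta. -/
def kdel (a b : ℕ) : ℕ := if a = b then 1 else 0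

/-- `p̃(n) = 1` if `n` is odd, `0` otherwise. -/
def ptil (n : ℕ) : ℚ := if n % 2 = 1 then 1 else 0

/-- The vector `u^i_{a,b}`. -/
def uvec (p i a b : ℕ) : Fin (p - 1) → ℚ := fun j =>
  (if 1 < a then evec p a j else 0) + (if 1 < b then evec p b j else 0)
    + ptil (a + kdel a 1 + b + kdel b 1 + (if i = 1 then p - 1 else 0)) * (evec p 1 j - evec p 0 j)

/-- The vector `A^i_{a,b}`. -/
def Avec (p i a b : ℕ) : Fin (p - 1) → ℚ := fun j =>
  (if 1 < b then evec p b j else 0)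
    + ptil (a + kdel a 1 + b + kdel b 1 + (if i = 1 then p - 1 else 0)) * evec p 1 j

/-- `q`-binomial coefficient with (possibly non-integral) rational top entry:
it vanishes unless the top is an integer `N` with `0 ≤ m ≤ N`. -/
def qBinQ (q : ℝ) (N : ℚ) (m : ℕ) : ℝ :=
  if N.den = 1 ∧ (m : ℚ) ≤ N then
    qPoch q N.num.toNat / (qPoch q m * qPoch q (N.num.toNat - m))
  else 0

/-- The quadratic form `Φ(m) = (m·C̃m)/4 - (A·m)/2`. -/
def PhiQ (p : ℕ) (A : Fin (p - 1) → ℚ) (m : Fin (p - 1) → ℕ) : ℚ :=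
  (∑ i, ∑ j, (m i : ℚ) * CtM p i j * (m j : ℚ)) / 4 - (∑ j, A j * (m j : ℚ)) / 2

/-- The vector `(½ Ĩ m + L e₀ + ½ u)`. -/
def topVec (p L : ℕ) (u : Fin (p - 1) → ℚ) (m : Fin (p - 1) → ℕ) (i : Fin (p - 1)) : ℚ :=
  (∑ j, ItM p i j * (m j : ℚ)) / 2 + (L : ℚ) * evec p 0 i + u i / 2

/-- The last component `m_{p-2}`. -/
def mlast (p : ℕ) (m : Fin (p - 1) → ℕ) : ℕ :=
  if h : p - 1 ≠ 0 then m ⟨p - 2, by omega⟩ else 0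

/-- The fundamental fermionic form `f^p_k(L; u; A)`. -/
def fFerm (q : ℝ) (p k L : ℕ) (u A : Fin (p - 1) → ℚ) : ℝ :=
  ∑' m : Fin (p - 1) → ℕ,
    if mlast p m % 2 = k % 2 then
      q ^ ((PhiQ p A m : ℝ)) * ∏ i, qBinQ q (topVec p L u m i) (m i)
    else 0

/-- The fermionic polynomial `F^{p,i}_{a,b}(L)`. -/
def Fpoly (q : ℝ) (p i a b L : ℕ) : ℝ :=
  if b = p - 1 then fFerm q p (1 - i) L (uvec p i a b) (Avec p i a b)
  else fFerm q p i L (uvec p i a b) (Avec p i a b)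

def phiR (a b : ℝ) : ℝ := (b - a) * (b - a + 1) / 4

def phitR (a b : ℝ) : ℝ := (b - a) * (b - a + 3) / 4

/-- Virasoro character `χ^{p,p+1}_{r,s}(q)` of the minimal model `M(p,p+1)`. -/
def chiV (p r s : ℤ) (q : ℝ) : ℝ :=
  (∑' j : ℤ, (q ^ (p * (p + 1) * j ^ 2 + j * ((p + 1) * r - p * s))
      - q ^ ((p * j + r) * ((p + 1) * j + s)))) / qPochInf q

lemma qPoch_succ (q : ℝ) (k : ℕ) : qPoch q (k+1) = qPoch q k * (1 - q^(k+1)) := by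
  simp [qPoch, Finset.prod_range_succ]

lemma qPoch_zero (q : ℝ) : qPoch q 0 = 1 := by simp [qPoch]

lemma one_sub_pow_pos {q : ℝ} (h0 : 0 < q) (h1 : q < 1) (k : ℕ) : 0 < 1 - q^(k+1) := by
  have := pow_lt_one₀ h0.le h1 (n := k+1) (by omega)
  linarith

lemma qPoch_pos {q : ℝ} (h0 : 0 < q) (h1 : q < 1) (k : ℕ) : 0 < qPoch q k :=
  Finset.prod_pos (fun j _ => one_sub_pow_pos h0 h1 j)

/-- `(q)_n` for integer `n ≥ 1`. -/
lemma qPoch_toNat (q : ℝ) (n : ℤ) (hn : 1 ≤ n) :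
    qPoch q n.toNat = qPoch q (n-1).toNat * (1 - q^n) := by
  obtain ⟨k, rfl⟩ : ∃ k : ℕ, n = k + 1 := ⟨(n-1).toNat, by omega⟩
  have h1 : ((k:ℤ)+1).toNat = k+1 := by omega
  have h2 : ((k:ℤ)+1-1).toNat = k := by omega
  rw [h1, h2, qPoch_succ]
  norm_cast

/-- multinomial coefficient with two free lower entries -/
def Mt (q : ℝ) (N j k : ℤ) : ℝ :=
  if 0 ≤ j ∧ 0 ≤ k ∧ j + k ≤ N then
    qPoch q N.toNat / (qPoch q j.toNat * qPoch q k.toNat * qPoch q (N-j-k).toNat) else 0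

lemma Mt_symm (q : ℝ) (N j k : ℤ) : Mt q N j k = Mt q N k j := by
  unfold Mt
  have h : N - j - k = N - k - j := by ring
  rw [h, mul_comm (qPoch q j.toNat)]
  congr 1
  apply propext
  constructor <;> intro h <;> refine ⟨?_, ?_, ?_⟩ <;> omega

lemma Mt_j {q : ℝ} (h0 : 0 < q) (h1 : q < 1) (N j k : ℤ) :
    (1 - q^j) * Mt q N j k = (1 - q^N) * Mt q (N-1) (j-1) k := by
  unfold Mt
  by_cases hj : 1 ≤ j
  · by_cases hc : 0 ≤ j ∧ 0 ≤ k ∧ j + k ≤ N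
    · have hc' : 0 ≤ j - 1 ∧ 0 ≤ k ∧ j - 1 + k ≤ N - 1 := by omega
      rw [if_pos hc, if_pos hc', qPoch_toNat q N (by omega), qPoch_toNat q j hj]
      have e : N - 1 - (j-1) - k = N - j - k := by ring
      rw [e]
      have p1 := (qPoch_pos h0 h1 (j-1).toNat).ne'
      have p2 := (qPoch_pos h0 h1 k.toNat).ne'
      have p3 := (qPoch_pos h0 h1 (N-j-k).toNat).ne'
      have p4 : 1 - q^j ≠ 0 := by
        have := (one_sub_pow_pos h0 h1 (j-1).toNat).ne'
        have e : q^j = q^((j-1).toNat+1) := by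
          rw [← zpow_natCast]; congr 1; push_cast; omega
        rwa [e]
      field_simp
    · have hc' : ¬ (0 ≤ j - 1 ∧ 0 ≤ k ∧ j - 1 + k ≤ N - 1) := by omega
      rw [if_neg hc, if_neg hc']; simp
  · have hc' : ¬ (0 ≤ j - 1 ∧ 0 ≤ k ∧ j - 1 + k ≤ N - 1) := by omega
    rw [if_neg hc']
    by_cases hj0 : j = 0
    · simp [hj0]
    · have hc : ¬ (0 ≤ j ∧ 0 ≤ k ∧ j + k ≤ N) := by omega
      rw [if_neg hc]; simp

lemma Mt_k {q : ℝ} (h0 : 0 < q) (h1 : q < 1) (N j k : ℤ) :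
    (1 - q^k) * Mt q N j k = (1 - q^N) * Mt q (N-1) j (k-1) := by
  rw [Mt_symm, Mt_j h0 h1, Mt_symm]

lemma Mt_l_symm (q : ℝ) (N j k : ℤ) : Mt q N j k = Mt q N j (N-j-k) := by
  unfold Mt
  have h : N - j - (N - j - k) = k := by ring
  rw [h, mul_right_comm]
  congr 1
  apply propext
  constructor <;> intro h <;> refine ⟨?_, ?_, ?_⟩ <;> omega

lemma Mt_l {q : ℝ} (h0 : 0 < q) (h1 : q < 1) (N j k : ℤ) :
    (1 - q^(N-j-k)) * Mt q N j k = (1 - q^N) * Mt q (N-1) j k := by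
  rw [Mt_l_symm, Mt_k h0 h1, Mt_l_symm]
  congr 2; ring

lemma one_sub_zpow_ne {q : ℝ} (h0 : 0 < q) (h1 : q < 1) {N : ℤ} (hN : N ≠ 0) : 1 - q^N ≠ 0 := by
  intro h
  have : q^N = 1 := by linarith
  rw [zpow_eq_one_iff_right₀ h0.le h1.ne] at this
  exact hN this

lemma Mt_neg (q : ℝ) {N : ℤ} (hN : N < 0) (j k : ℤ) : Mt q N j k = 0 := by
  unfold Mt; rw [if_neg (by omega)]

lemma Mt_lk {q : ℝ} (h0 : 0 < q) (h1 : q < 1) (N j k : ℤ) :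
    (1 - q^(N-j-k)) * Mt q N j k = (1 - q^(k+1)) * Mt q N j (k+1) := by
  rw [Mt_l h0 h1, Mt_k h0 h1]; congr 2; ring

/-- Pascal, order `k, j, l`. -/
lemma Mt_pascal1 {q : ℝ} (h0 : 0 < q) (h1 : q < 1) {N : ℤ} (hN : N ≠ 0) (j k : ℤ) :
    Mt q N j k = Mt q (N-1) j (k-1) + q^k * Mt q (N-1) (j-1) k
      + q^(j+k) * Mt q (N-1) j k := by
  have hne := one_sub_zpow_ne h0 h1 hN
  apply mul_left_cancel₀ hne
  have a1 := Mt_j h0 h1 N j k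
  have a2 := Mt_k h0 h1 N j k
  have a3 := Mt_l h0 h1 N j k
  have e1 : q^(j+k) = q^j*q^k := zpow_add₀ h0.ne' _ _
  have e2 : q^(j+k) * q^(N-j-k) = q^N := by rw [← zpow_add₀ h0.ne']; congr 1; ring
  linear_combination a2 + q^k * a1 + q^(j+k)*a3 + (Mt q N j k) * e2 - Mt q N j k * e1

/-- Pascal, order `l, k, j`. -/
lemma Mt_pascal2 {q : ℝ} (h0 : 0 < q) (h1 : q < 1) {N : ℤ} (hN : N ≠ 0) (j k : ℤ) :
    Mt q N j k = Mt q (N-1) j k + q^(N-j-k) * Mt q (N-1) j (k-1)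
      + q^(N-j) * Mt q (N-1) (j-1) k := by
  have hne := one_sub_zpow_ne h0 h1 hN
  apply mul_left_cancel₀ hne
  have a1 := Mt_j h0 h1 N j k
  have a2 := Mt_k h0 h1 N j k
  have a3 := Mt_l h0 h1 N j k
  have e1 : q^(N-j-k) * q^k = q^(N-j) := by rw [← zpow_add₀ h0.ne']; congr 1; ring
  have e2 : q^(N-j) * q^j = q^N := by rw [← zpow_add₀ h0.ne']; congr 1; ring
  linear_combination a3 + q^(N-j-k) * a2 + q^(N-j)*a1 + (Mt q N j k) * e2 + Mt q N j k * e1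

lemma Mt_summ (q : ℝ) (N d e : ℤ) (c : ℤ → ℝ) :
    Summable (fun j : ℤ => c j * Mt q N (j+d) (j+e)) := by
  apply summable_of_hasFiniteSupport
  apply (Set.finite_Icc (-d) (N-d+|e-d|+|N|)).subset
  intro j hj
  by_contra h
  apply hj
  have : ¬ (0 ≤ j+d ∧ 0 ≤ j+e ∧ j+d+(j+e) ≤ N) := by
    rintro ⟨a, b, c⟩
    apply h
    simp only [Set.mem_Icc]
    have := le_abs_self N
    have := abs_nonneg (e-d)
    have := abs_nonneg N
    omega
  simp [Mt, this]

/-- The `q`-trinomial coefficient. -/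
def TT (q : ℝ) (n L A : ℤ) : ℝ := ∑' j : ℤ, q^(j*(j+A-n)) * Mt q L j (j+A)

lemma TT_hasSum (q : ℝ) (n L A : ℤ) :
    HasSum (fun j : ℤ => q^(j*(j+A-n)) * Mt q L j (j+A)) (TT q n L A) := by
  have := Mt_summ q L 0 A (fun j => q^(j*(j+A-n)))
  simp only [add_zero] at this
  exact this.hasSum

lemma hasSum_shift {f : ℤ → ℝ} {s : ℝ} (h : HasSum f s) : HasSum (fun j => f (j-1)) s :=
  (Equiv.hasSum_iff (Equiv.subRight (1:ℤ))).2 h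

lemma hs_congr {ι : Type*} {f g : ι → ℝ} {s t : ℝ} (h : HasSum f s) (e : ∀ j, g j = f j)
    (e2 : t = s) : HasSum g t := by
  have : g = f := funext e
  rw [this, e2]; exact h

lemma TT_neg (q : ℝ) (n L A : ℤ) (hL : L < 0) : TT q n L A = 0 := by
  unfold TT; simp [Mt_neg q hL]

lemma TT_zero_of (q : ℝ) (n L A : ℤ) (hL : L < |A|) : TT q n L A = 0 := by
  unfold TT
  have : ∀ j : ℤ, Mt q L j (j+A) = 0 := by
    intro j
    unfold Mt
    rw [if_neg]
    rintro ⟨a, b, c⟩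
    rcases abs_cases A with h | h <;> omega
  simp [this]

lemma TT_zero_zero (q : ℝ) (n : ℤ) : TT q n 0 0 = 1 := by
  unfold TT
  rw [tsum_eq_single 0]
  · simp [Mt, qPoch]
  · intro j hj
    simp only [Mt]
    rw [if_neg (by omega)]; simp

lemma T1rec {q : ℝ} (h0 : 0 < q) (h1 : q < 1) (L A : ℤ) (hL : L ≠ 0) :
    TT q 1 L A = q^(L-1) * TT q 1 (L-1) A + q^A * TT q 0 (L-1) (A+1) + TT q 0 (L-1) (A-1) := by
  have b1 := (TT_hasSum q 1 (L-1) A).mul_left (q^(L-1))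
  have b2 := (hasSum_shift (TT_hasSum q 0 (L-1) (A+1))).mul_left (q^A)
  have b3 := TT_hasSum q 0 (L-1) (A-1)
  have hs := (Mt_summ q (L-1) 0 A
    (fun j => q^(j*(j+A)+(j+A)) * (1 - q^(L-1-j-(j+A))))).hasSum
  have hs' := hasSum_shift hs
  have tot := ((b1.add b2).add b3).add (hs.add (hs'.mul_left (-1)))
  refine (TT_hasSum q 1 L A).unique (hs_congr tot ?_ (by ring))
  intro j
  have k1 := Mt_lk h0 h1 (L-1) (j-1) (j-1+A)
  have e1 : j - 1 + (A+1) = j + A := by ring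
  have e2 : j + (A - 1) = j + A - 1 := by ring
  have e3 : j - 1 + A + 1 = j + A := by ring
  simp only [add_zero]
  rw [Mt_pascal1 h0 h1 hL, e1, e2]
  rw [e3] at k1
  set k := j + A with hk
  have hA : A = k - j := by omega
  rw [mul_assoc (q^((j-1)*(j-1+A)+(j-1+A))), k1]
  have f1 : q^(j*(k-1)) * q^k = q^(j*(k-1)+k) := by rw [← zpow_add₀ h0.ne']
  have f2 : q^(j*(k-1)) * q^(j+k) = q^(j*k+k) := by
    rw [← zpow_add₀ h0.ne']; congr 1; ring
  have f3 : q^(L-1) * q^(j*(k-1)) = q^(j*k+k) * q^(L-1-j-k) := by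
    rw [← zpow_add₀ h0.ne', ← zpow_add₀ h0.ne']; congr 1; ring
  have f4 : q^A * q^((j-1)*(k-0)) = q^(j*(k-1)) := by
    rw [← zpow_add₀ h0.ne']; congr 1; rw [hA]; ring
  have f5 : q^((j-1)*(j-1+A)+(j-1+A)) = q^(j*(k-1)) := by
    congr 1; rw [hA]; ring
  have f6 : q^(j*(k-1-0)) = q^(j*(k-1)) := by simp
  rw [f5, f6]
  linear_combination (Mt q (L-1) j k) * f2 - (Mt q (L-1) j k) * f3 - (Mt q (L-1) (j-1) k) * f4

lemma T2rec {q : ℝ} (h0 : 0 < q) (h1 : q < 1) (L A : ℤ) (hL : L ≠ 0) :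
    TT q 0 L A = TT q 0 (L-1) A + q^(L-1) * (q^(1-A) * TT q 1 (L-1) (A-1) + TT q 1 (L-1) (A+1))
      + (q^(2*L-2) - q^(L-1)) * TT q 0 (L-2) A := by
  have b1 := TT_hasSum q 0 (L-1) A
  have b2 := (TT_hasSum q 1 (L-1) (A-1)).mul_left (q^(L-1)*q^(1-A))
  have b3 := (hasSum_shift (TT_hasSum q 1 (L-1) (A+1))).mul_left (q^(L-1))
  have b4 := (hasSum_shift (TT_hasSum q 0 (L-2) A)).mul_left (q^(2*L-2) - q^(L-1))
  have tot := ((b1.add b2).add b3).add b4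
  refine (TT_hasSum q 0 L A).unique ?_
  convert tot using 1
  swap
  · ring
  funext j
  have k1 := Mt_k h0 h1 (L-1) (j-1) (j+A)
  have e1 : j - 1 + (A+1) = j + A := by ring
  have e2 : j + (A - 1) = j + A - 1 := by ring
  have e3 : j - 1 + A = j + A - 1 := by ring
  have e4 : L - 1 - 1 = L - 2 := by ring
  rw [Mt_pascal2 h0 h1 hL, e1, e2, e3]
  rw [e4] at k1
  set k := j + A with hk
  have hA : A = k - j := by omega
  have f1 : q^(j*(k-0)) * q^(L-j-k) = q^(L-1)*q^(1-A)*q^(j*(k-1-1)) := by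
    rw [← zpow_add₀ h0.ne', ← zpow_add₀ h0.ne', ← zpow_add₀ h0.ne']; congr 1; rw [hA]; ring
  have f2 : q^(j*(k-0)) * q^(L-j) = q^(L-1)*q^((j-1)*(k-1))*q^k := by
    rw [← zpow_add₀ h0.ne', ← zpow_add₀ h0.ne', ← zpow_add₀ h0.ne']; congr 1; ring
  have f3 : q^(2*L-2) = q^(L-1)*q^(L-1) := by
    rw [← zpow_add₀ h0.ne']; congr 1; ring
  have f4 : q^((j-1)*(k-1-0)) = q^((j-1)*(k-1)) := by simp
  rw [f4, f3]
  linear_combination (Mt q (L-1) j (k-1)) * f1 + (Mt q (L-1) (j-1) k) * f2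
    - q^(L-1)*q^((j-1)*(k-1)) * k1

lemma W2 {q : ℝ} (h0 : 0 < q) (h1 : q < 1) (L A : ℤ) :
    (1 - q^A) * TT q 1 L A = (1 - q^L) * (TT q 0 (L-1) (A-1) - q^(2*A) * TT q 0 (L-1) (A+1)) := by
  have b1 := TT_hasSum q 0 (L-1) (A-1)
  have b2 := (hasSum_shift (TT_hasSum q 0 (L-1) (A+1))).mul_left (q^(2*A))
  have tot := (b1.sub b2).mul_left (1 - q^L)
  refine ((TT_hasSum q 1 L A).mul_left (1-q^A)).unique ?_
  convert tot using 1
  funext j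
  have k1 := Mt_k h0 h1 L j (j+A)
  have k2 := Mt_j h0 h1 L j (j+A)
  have e1 : j - 1 + (A+1) = j + A := by ring
  have e2 : j + (A - 1) = j + A - 1 := by ring
  rw [e1, e2]
  set k := j + A with hk
  have hA : A = k - j := by omega
  have f1 : q^(2*A)*q^((j-1)*(k-0)) = q^A * q^(j*(k-1)) := by
    rw [← zpow_add₀ h0.ne', ← zpow_add₀ h0.ne']; congr 1; rw [hA]; ring
  have f2 : q^A * q^j = q^k := by
    rw [← zpow_add₀ h0.ne']; congr 1; rw [hA]; ring
  have f4 : q^(j*(k-1-0)) = q^(j*(k-1)) := by simp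
  rw [f4]
  linear_combination q^(j*(k-1)) * k1 - q^A*q^(j*(k-1)) * k2 + (1-q^L)*(Mt q (L-1) (j-1) k) * f1
    - q^(j*(k-1))*(Mt q L j k)*f2

lemma W1 {q : ℝ} (h0 : 0 < q) (h1 : q < 1) (L A : ℤ) :
    (1 - q^A) * TT q 0 L A = (1 - q^L) * ((1 - q^A) * TT q 0 (L-1) A +
      q^(L-1) * (q^(1-A) * TT q 1 (L-1) (A-1) - q^A * TT q 1 (L-1) (A+1))) := by
  have b1 := (TT_hasSum q 0 (L-1) A).mul_left (1-q^A)
  have b2 := (TT_hasSum q 1 (L-1) (A-1)).mul_left (q^(1-A))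
  have b3 := (hasSum_shift (TT_hasSum q 1 (L-1) (A+1))).mul_left (q^A)
  have tot := (b1.add ((b2.sub b3).mul_left (q^(L-1)))).mul_left (1 - q^L)
  refine ((TT_hasSum q 0 L A).mul_left (1-q^A)).unique ?_
  convert tot using 1
  funext j
  have k1 := Mt_k h0 h1 L j (j+A)
  have k2 := Mt_j h0 h1 L j (j+A)
  have k3 := Mt_l h0 h1 L j (j+A)
  have e1 : j - 1 + (A+1) = j + A := by ring
  have e2 : j + (A - 1) = j + A - 1 := by ring
  rw [e1, e2]
  set k := j + A with hk
  have hA : A = k - j := by omega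
  have f1 : q^(L-1)*q^(1-A)*q^(j*(k-1-1)) = q^(L-j-k) * q^(j*(k-0)) := by
    rw [← zpow_add₀ h0.ne', ← zpow_add₀ h0.ne', ← zpow_add₀ h0.ne']; congr 1; rw [hA]; ring
  have f3 : q^(L-1)*q^A*q^((j-1)*(k-1)) = q^(L-j-k) * q^A * q^(j*(k-0)) * q^(-A) * q^A := by
    simp only [← zpow_add₀ h0.ne']; congr 1; rw [hA]; ring
  have f5 : q^(-A) * q^A = 1 := by
    rw [← zpow_add₀ h0.ne']; simp
  have f2 : q^A * q^j = q^k := by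
    rw [← zpow_add₀ h0.ne']; congr 1; rw [hA]; ring
  have f6 := f3.trans (by rw [mul_assoc, f5, mul_one])
  linear_combination q^(j*(k-0)) * (1-q^A) * k3 + q^(L-j-k) * q^(j*(k-0)) * k1
   - q^(L-j-k)*q^A*q^(j*(k-0)) * k2 - (1-q^L)*(Mt q (L-1) j (k-1)) * f1
   + (1-q^L)*(Mt q (L-1) (j-1) k) * f6 - q^(L-j-k) *q^(j*(k-0))*(Mt q L j k)*f2

/-- triangular numbers -/
def tri (c : ℤ) : ℤ := c * (c + 1) / 2

lemma tri_mul (c : ℤ) : 2 * tri c = c * (c+1) := by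
  unfold tri
  have : (2:ℤ) ∣ c * (c+1) := (Int.even_mul_succ_self c).two_dvd
  omega

lemma tri_succ (a b : ℤ) : tri (b + 1 - a) = tri (b - a) + (b - a + 1) := by
  have h1 := tri_mul (b+1-a)
  have h2 := tri_mul (b-a)
  have : (b+1-a) * (b+1-a+1) = (b-a)*(b-a+1) + 2*(b-a+1) := by ring
  linarith

lemma tri_pred (a b : ℤ) : tri (b - 1 - a) = tri (b - a) - (b - a) := by
  have := tri_succ a (b-1)
  rw [sub_add_cancel] at this
  linarith

lemma TT_summ (q : ℝ) (n L : ℤ) {p : ℤ} (hp : 1 ≤ p) (d : ℤ) (c : ℤ → ℝ) :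
    Summable (fun j : ℤ => c j * TT q n L (2*p*j+d)) := by
  apply summable_of_hasFiniteSupport
  apply (Set.finite_Icc (-(|L|+|d|)) (|L|+|d|)).subset
  intro j hj
  by_contra h
  apply hj
  have : L < |2*p*j+d| := by
    have hj' : |L| + |d| < |j| := by
      by_contra h'
      apply h
      rw [not_lt, abs_le] at h'
      exact h'
    have h1 : |j| ≤ |2*p*j| := by
      rw [abs_mul]
      have : (1:ℤ) ≤ |2*p| := by rw [abs_of_nonneg (by omega)]; omega
      nlinarith [abs_nonneg j]
    have h2 : |2*p*j| ≤ |2*p*j+d| + |d| := by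
      have := abs_sub (2*p*j+d) d
      simpa using this
    have := le_abs_self L
    omega
  simp [TT_zero_of q n L _ this]

def exE (p a b j : ℤ) : ℤ := p*(p+1)*j^2 + j*((p+1)*a - p*(b+1))
def exE' (p a b j : ℤ) : ℤ := (p*j+a)*((p+1)*j+(b+1))
def exO (p a b j : ℤ) : ℤ := p*(p+1)*j^2 + j*((p+1)*a - p*(b+2))
def exO' (p a b j : ℤ) : ℤ := p*(p+1)*j^2 + j*((p+1)*a + p*b) + a*(b+1) - b

def bEp (r : ℝ) (p a b L j : ℤ) : ℝ :=
  r^(tri (b-a)) * (r^2)^(exE p a b j) * TT (r^2) 0 L (2*p*j+(a-b))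
def bEm (r : ℝ) (p a b L j : ℤ) : ℝ :=
  r^(tri (b-a)) * (r^2)^(exE' p a b j) * TT (r^2) 0 L (2*p*j+(a+b))
def bOp (r : ℝ) (p a b L j : ℤ) : ℝ :=
  r^(tri (b-a) + (b-a)) * (r^2)^(exO p a b j) * TT (r^2) 1 L (2*p*j+(a-b))
def bOm (r : ℝ) (p a b L j : ℤ) : ℝ :=
  r^(tri (b-a) + (b-a)) * (r^2)^(exO' p a b j) * TT (r^2) 1 L (2*p*j+(a+b))

def bE (r : ℝ) (p a b L : ℤ) : ℝ := ∑' j : ℤ, (bEp r p a b L j - bEm r p a b L j)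
def bO (r : ℝ) (p a b L : ℤ) : ℝ := ∑' j : ℤ, (bOp r p a b L j - bOm r p a b L j)

section
variable {r : ℝ} {p : ℤ}

lemma bEp_summ (hp : 1 ≤ p) (a b L : ℤ) : Summable (bEp r p a b L) :=
  TT_summ (r^2) 0 L hp (a-b) (fun j => r^(tri (b-a)) * (r^2)^(exE p a b j))
lemma bEm_summ (hp : 1 ≤ p) (a b L : ℤ) : Summable (bEm r p a b L) :=
  TT_summ (r^2) 0 L hp (a+b) (fun j => r^(tri (b-a)) * (r^2)^(exE' p a b j))
lemma bOp_summ (hp : 1 ≤ p) (a b L : ℤ) : Summable (bOp r p a b L) :=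
  TT_summ (r^2) 1 L hp (a-b) (fun j => r^(tri (b-a)+(b-a)) * (r^2)^(exO p a b j))
lemma bOm_summ (hp : 1 ≤ p) (a b L : ℤ) : Summable (bOm r p a b L) :=
  TT_summ (r^2) 1 L hp (a+b) (fun j => r^(tri (b-a)+(b-a)) * (r^2)^(exO' p a b j))

lemma bE_hasSum (hp : 1 ≤ p) (a b L : ℤ) :
    HasSum (fun j => bEp r p a b L j - bEm r p a b L j) (bE r p a b L) :=
  ((bEp_summ hp a b L).sub (bEm_summ hp a b L)).hasSum
lemma bO_hasSum (hp : 1 ≤ p) (a b L : ℤ) :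
    HasSum (fun j => bOp r p a b L j - bOm r p a b L j) (bO r p a b L) :=
  ((bOp_summ hp a b L).sub (bOm_summ hp a b L)).hasSum

lemma sq_zpow (r : ℝ) (n : ℤ) : (r^2)^n = r^(2*n) := by
  rw [zpow_mul]; norm_cast

lemma bO_rec (h0 : 0 < r) (h1 : r < 1) (hp : 1 ≤ p) (a b L : ℤ) (hL : L ≠ 0) :
    bO r p a b L = r⁻¹ * bE r p a (b+1) (L-1) + bE r p a (b-1) (L-1)
      + (r^2)^(L-1) * bO r p a b (L-1) := by
  have hq0 : 0 < r^2 := by positivity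
  have hq1 : r^2 < 1 := by nlinarith
  have tot := (((bE_hasSum (r := r) hp a (b+1) (L-1)).mul_left (r⁻¹)).add
    (bE_hasSum (r := r) hp a (b-1) (L-1))).add
    ((bO_hasSum (r := r) hp a b (L-1)).mul_left ((r^2)^(L-1)))
  refine (bO_hasSum hp a b L).unique (hs_congr tot ?_ rfl)
  intro j
  unfold bOp bOm bEp bEm
  rw [T1rec hq0 hq1 _ _ hL, T1rec hq0 hq1 _ _ hL, tri_succ, tri_pred]
  rw [show 2*p*j+(a-b)-1 = 2*p*j + (a-(b+1)) by ring,
    show 2*p*j+(a-b)+1 = 2*p*j + (a-(b-1)) by ring,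
    show 2*p*j+(a+b)-1 = 2*p*j + (a+(b-1)) by ring,
    show 2*p*j+(a+b)+1 = 2*p*j + (a+(b+1)) by ring]
  simp only [sq_zpow]
  set t := tri (b-a)
  have ri : r⁻¹ = r^(-1:ℤ) := by simp
  rw [ri]
  have f1 : r^(t+(b-a)) * r^(2*exO p a b j) =
      r^(-1:ℤ) * (r^(t+(b-a+1)) * r^(2*exE p a (b+1) j)) := by
    simp only [← zpow_add₀ h0.ne']; congr 1; unfold exO exE; ring
  have f2 : r^(t+(b-a)) * r^(2*exO p a b j) * r^(2*(2*p*j+(a-b))) =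
      (r^(t-(b-a)) * r^(2*exE p a (b-1) j)) := by
    simp only [← zpow_add₀ h0.ne']; congr 1; unfold exO exE; ring
  have f3 : r^(t+(b-a)) * r^(2*exO' p a b j) * r^(2*(2*p*j+(a+b))) =
      r^(-1:ℤ) * (r^(t+(b-a+1)) * r^(2*exE' p a (b+1) j)) := by
    simp only [← zpow_add₀ h0.ne']; congr 1; unfold exO' exE'; ring
  have f4 : r^(t+(b-a)) * r^(2*exO' p a b j) =
      (r^(t-(b-a)) * r^(2*exE' p a (b-1) j)) := by
    simp only [← zpow_add₀ h0.ne']; congr 1; unfold exO' exE'; ring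
  linear_combination (TT (r^2) 0 (L-1) (2*p*j + (a-(b+1)))) * f1
    + (TT (r^2) 0 (L-1) (2*p*j + (a-(b-1)))) * f2
    - (TT (r^2) 0 (L-1) (2*p*j + (a+(b+1)))) * f3
    - (TT (r^2) 0 (L-1) (2*p*j + (a+(b-1)))) * f4

lemma bE_rec (h0 : 0 < r) (h1 : r < 1) (hp : 1 ≤ p) (a b L : ℤ) (hL : L ≠ 0) :
    bE r p a b L = bE r p a b (L-1) + (r^2)^(L-1) * bO r p a (b+1) (L-1)
      + r^(2*L-1) * bO r p a (b-1) (L-1)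
      + ((r^2)^(2*L-2) - (r^2)^(L-1)) * bE r p a b (L-2) := by
  have hq0 : 0 < r^2 := by positivity
  have hq1 : r^2 < 1 := by nlinarith
  have tot := (((bE_hasSum (r := r) hp a b (L-1)).add
    ((bO_hasSum (r := r) hp a (b+1) (L-1)).mul_left ((r^2)^(L-1)))).add
    ((bO_hasSum (r := r) hp a (b-1) (L-1)).mul_left (r^(2*L-1)))).add
    ((bE_hasSum (r := r) hp a b (L-2)).mul_left ((r^2)^(2*L-2) - (r^2)^(L-1)))
  refine (bE_hasSum hp a b L).unique (hs_congr tot ?_ rfl)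
  intro j
  unfold bOp bOm bEp bEm
  rw [T2rec hq0 hq1 _ _ hL, T2rec hq0 hq1 _ _ hL, tri_succ, tri_pred]
  rw [show 2*p*j+(a-b)-1 = 2*p*j + (a-(b+1)) by ring,
    show 2*p*j+(a-b)+1 = 2*p*j + (a-(b-1)) by ring,
    show 2*p*j+(a+b)-1 = 2*p*j + (a+(b-1)) by ring,
    show 2*p*j+(a+b)+1 = 2*p*j + (a+(b+1)) by ring]
  simp only [sq_zpow]
  set t := tri (b-a)
  have f1 : r^t * r^(2*exE p a b j) * (r^(2*(L-1)) * r^(2*(1-(2*p*j+(a-b))))) =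
      r^(2*(L-1)) * (r^(t+(b-a+1)+(b+1-a)) * r^(2*exO p a (b+1) j)) := by
    simp only [← zpow_add₀ h0.ne']; congr 1; unfold exO exE; ring
  have f2 : r^t * r^(2*exE p a b j) * r^(2*(L-1)) =
      r^(2*L-1) * (r^(t-(b-a)+(b-1-a)) * r^(2*exO p a (b-1) j)) := by
    simp only [← zpow_add₀ h0.ne']; congr 1; unfold exO exE; ring
  have f3 : r^t * r^(2*exE' p a b j) * r^(2*(L-1)) =
      r^(2*(L-1)) * (r^(t+(b-a+1)+(b+1-a)) * r^(2*exO' p a (b+1) j)) := by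
    simp only [← zpow_add₀ h0.ne']; congr 1; unfold exO' exE'; ring
  have f4 : r^t * r^(2*exE' p a b j) * (r^(2*(L-1)) * r^(2*(1-(2*p*j+(a+b))))) =
      r^(2*L-1) * (r^(t-(b-a)+(b-1-a)) * r^(2*exO' p a (b-1) j)) := by
    simp only [← zpow_add₀ h0.ne']; congr 1; unfold exO' exE'; ring
  linear_combination (TT (r^2) 1 (L-1) (2*p*j + (a-(b+1)))) * f1
    + (TT (r^2) 1 (L-1) (2*p*j + (a-(b-1)))) * f2
    - (TT (r^2) 1 (L-1) (2*p*j + (a+(b+1)))) * f3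
    - (TT (r^2) 1 (L-1) (2*p*j + (a+(b-1)))) * f4

lemma bE_p (hp : 1 ≤ p) (a L : ℤ) : bE r p a p L = 0 := by
  have e1 := (bEp_summ (r := r) hp a p L).hasSum
  have e2 := (bEm_summ (r := r) hp a p L).hasSum
  have e3 := hasSum_shift e2
  have : (fun j => bEm r p a p L (j-1)) = bEp r p a p L := by
    funext j
    unfold bEm bEp
    rw [show 2*p*(j-1)+(a+p) = 2*p*j+(a-p) by ring,
      show exE' p a p (j-1) = exE p a p j by unfold exE exE'; ring]
  rw [this] at e3
  have h := e3.unique e1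
  unfold bE
  rw [(bEp_summ hp a p L).tsum_sub (bEm_summ hp a p L), h, sub_self]

lemma bO_p (hp : 1 ≤ p) (a L : ℤ) : bO r p a p L = 0 := by
  have e1 := (bOp_summ (r := r) hp a p L).hasSum
  have e2 := (bOm_summ (r := r) hp a p L).hasSum
  have e3 := hasSum_shift e2
  have : (fun j => bOm r p a p L (j-1)) = bOp r p a p L := by
    funext j
    unfold bOm bOp
    rw [show 2*p*(j-1)+(a+p) = 2*p*j+(a-p) by ring,
      show exO' p a p (j-1) = exO p a p j by unfold exO exO'; ring]
  rw [this] at e3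
  have h := e3.unique e1
  unfold bO
  rw [(bOp_summ hp a p L).tsum_sub (bOm_summ hp a p L), h, sub_self]

lemma bE_wall (h0 : 0 < r) (h1 : r < 1) (hp : 1 ≤ p) (a L : ℤ) :
    bE r p a 0 L = (1 - (r^2)^L) * (bE r p a 0 (L-1) + (r^2)^(L-1) * bO r p a 1 (L-1)) := by
  have hq0 : 0 < r^2 := by positivity
  have hq1 : r^2 < 1 := by nlinarith
  have tot := ((bE_hasSum (r := r) hp a 0 (L-1)).add
    ((bO_hasSum (r := r) hp a 1 (L-1)).mul_left ((r^2)^(L-1)))).mul_left (1 - (r^2)^L)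
  refine (bE_hasSum hp a 0 L).unique (hs_congr tot ?_ rfl)
  intro j
  have w := W1 hq0 hq1 L (2*p*j+a)
  have t1 : tri (1 - a) = tri (0-a) + (0-a+1) := by
    have := tri_succ a 0; simpa using this
  unfold bOp bOm bEp bEm
  rw [t1]
  rw [show 2*p*j+(a-1) = 2*p*j+a-1 by ring, show 2*p*j+(a+1) = 2*p*j+a+1 by ring, sub_zero,
    add_zero]
  simp only [sq_zpow] at w ⊢
  set t := tri (0-a)
  have f0 : r^(2*exE' p a 0 j) = r^(2*exE p a 0 j) * r^(2*(2*p*j+a)) := by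
    simp only [← zpow_add₀ h0.ne']; congr 1; unfold exE' exE; ring
  have f1 : r^t * r^(2*exE p a 0 j) * r^(2*(1-(2*p*j+a))) =
     r^(t+(0-a+1)+(1-a)) * r^(2*exO p a 1 j) := by
    simp only [← zpow_add₀ h0.ne']; congr 1; unfold exO exE; ring
  have f2 : r^t * r^(2*exE p a 0 j) * r^(2*(2*p*j+a)) =
     r^(t+(0-a+1)+(1-a)) * r^(2*exO' p a 1 j) := by
    simp only [← zpow_add₀ h0.ne']; congr 1; unfold exO' exE; ring
  rw [f0]
  linear_combination (r^t * r^(2*exE p a 0 j)) * w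
    + (1 - r^(2*L)) * r^(2*(L-1)) * (TT (r^2) 1 (L-1) (2*p*j+a-1)) * f1
    - (1 - r^(2*L)) * r^(2*(L-1)) * (TT (r^2) 1 (L-1) (2*p*j+a+1)) * f2

lemma bO_wall (h0 : 0 < r) (h1 : r < 1) (hp : 1 ≤ p) (a L : ℤ) :
    r * bO r p a 0 L = (1 - (r^2)^L) * bE r p a 1 (L-1) := by
  have hq0 : 0 < r^2 := by positivity
  have hq1 : r^2 < 1 := by nlinarith
  have tot := (bE_hasSum (r := r) hp a 1 (L-1)).mul_left (1 - (r^2)^L)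
  refine ((bO_hasSum hp a 0 L).mul_left r).unique (hs_congr tot ?_ rfl)
  intro j
  have w := W2 hq0 hq1 L (2*p*j+a)
  have t1 : tri (1 - a) = tri (0-a) + (0-a+1) := by
    have := tri_succ a 0; simpa using this
  unfold bOp bOm bEp bEm
  rw [t1]
  rw [show 2*p*j+(a-1) = 2*p*j+a-1 by ring, show 2*p*j+(a+1) = 2*p*j+a+1 by ring, sub_zero,
    add_zero]
  simp only [sq_zpow] at w ⊢
  set t := tri (0-a)
  have f0 : r^(2*exO' p a 0 j) = r^(2*exO p a 0 j) * r^(2*(2*p*j+a)) := by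
    simp only [← zpow_add₀ h0.ne']; congr 1; unfold exO' exO; ring
  have f1 : r^(t+(0-a+1)) * r^(2*exE p a 1 j) = r^(1:ℤ) * (r^(t+(0-a)) * r^(2*exO p a 0 j)) := by
    simp only [← zpow_add₀ h0.ne']; congr 1; unfold exO exE; ring
  have f2 : r^(t+(0-a+1)) * r^(2*exE' p a 1 j) =
      r^(1:ℤ) * (r^(t+(0-a)) * r^(2*exO p a 0 j)) * r^(2*(2*(2*p*j+a))) := by
    simp only [← zpow_add₀ h0.ne']; congr 1; unfold exO exE'; ring
  rw [zpow_one] at f1 f2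
  rw [f0]
  linear_combination (r * r^(t+(0-a)) * r^(2*exO p a 0 j)) * w
    - (1 - r^(2*L)) * (TT (r^2) 0 (L-1) (2*p*j+a-1)) * f1
    + (1 - r^(2*L)) * (TT (r^2) 0 (L-1) (2*p*j+a+1)) * f2

lemma bE_neg (a b L : ℤ) (hL : L < 0) : bE r p a b L = 0 := by
  unfold bE bEp bEm; simp [TT_neg _ _ _ _ hL]
lemma bO_neg (a b L : ℤ) (hL : L < 0) : bO r p a b L = 0 := by
  unfold bO bOp bOm; simp [TT_neg _ _ _ _ hL]

lemma TT_L0 (q : ℝ) (n A : ℤ) : TT q n 0 A = if A = 0 then 1 else 0 := by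
  split_ifs with h
  · rw [h, TT_zero_zero]
  · exact TT_zero_of _ _ _ _ (abs_pos.2 h)

lemma ne1 {p a b : ℤ} (j : ℤ) (ha : 1 ≤ a) (ha2 : a < p) (hb : 0 ≤ b) (hb2 : b ≤ p) :
    2*p*j+(a+b) ≠ 0 := by
  intro h
  rcases lt_trichotomy j 0 with h' | h' | h'
  · nlinarith
  · subst h'; omega
  · nlinarith

lemma ne2 {p a b : ℤ} (j : ℤ) (ha : 1 ≤ a) (ha2 : a < p) (hb : 0 ≤ b) (hb2 : b ≤ p) :
    2*p*j+(a-b) = 0 → j = 0 ∧ a = b := by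
  intro h
  rcases lt_trichotomy j 0 with h' | h' | h'
  · nlinarith
  · subst h'; omega
  · nlinarith

lemma bE_zero {a b : ℤ} (ha : 1 ≤ a) (ha2 : a < p) (hb : 0 ≤ b) (hb2 : b ≤ p) :
    bE r p a b 0 = if a = b then 1 else 0 := by
  unfold bE
  rw [tsum_eq_single 0]
  · unfold bEp bEm
    rw [TT_L0, TT_L0, if_neg (ne1 0 ha ha2 hb hb2)]
    by_cases h : a = b
    · subst h; simp [exE, tri]
    · rw [if_neg, if_neg h]
      · simp
      · intro h'; exact h (ne2 0 ha ha2 hb hb2 h').2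
  · intro j hj
    unfold bEp bEm
    rw [TT_L0, TT_L0, if_neg (ne1 j ha ha2 hb hb2), if_neg]
    · simp
    · intro h'; exact hj (ne2 j ha ha2 hb hb2 h').1

lemma bO_zero {a b : ℤ} (ha : 1 ≤ a) (ha2 : a < p) (hb : 0 ≤ b) (hb2 : b ≤ p) :
    bO r p a b 0 = if a = b then 1 else 0 := by
  unfold bO
  rw [tsum_eq_single 0]
  · unfold bOp bOm
    rw [TT_L0, TT_L0, if_neg (ne1 0 ha ha2 hb hb2)]
    by_cases h : a = b
    · subst h; simp [exO, tri]
    · rw [if_neg, if_neg h]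
      · simp
      · intro h'; exact h (ne2 0 ha ha2 hb hb2 h').2
  · intro j hj
    unfold bOp bOm
    rw [TT_L0, TT_L0, if_neg (ne1 j ha ha2 hb hb2), if_neg]
    · simp
    · intro h'; exact hj (ne2 j ha ha2 hb hb2 h').1
end

def ev (k i : ℕ) : ℤ := if i = k then 1 else 0
def srcv (a i : ℕ) : ℤ := if 1 < a ∧ i = a then 1 else 0
def nb (m : ℕ → ℕ) (i : ℕ) : ℤ :=
  if i = 0 then -(m 2 : ℤ) else if i = 1 then (m 2 : ℤ) else if i = 2 then m 1 + m 3 + m 0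
  else m (i-1) + m (i+1)
def sh (k : ℕ) (m : ℕ → ℕ) : ℕ → ℕ := fun j => m j + if j = k then 1 else 0
def colv (k i : ℕ) : ℤ :=
  (if 2 ≤ k ∧ i + 1 = k then 1 else 0) + (if i = k + 1 then 1 else 0)
    - (if k = 2 ∧ i = 0 then 1 else 0)
def bn (r : ℝ) (t : ℤ) (m : ℕ) : ℝ :=
  if Even t ∧ 2 * (m : ℤ) ≤ t then
    qPoch (r^2) (t/2).toNat / (qPoch (r^2) m * qPoch (r^2) ((t/2).toNat - m)) else 0
def fac (r : ℝ) (p i : ℕ) (t : ℤ) (m : ℕ) : ℝ :=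
  if i = p - 1 then (if m = 0 ∧ Even t then 1 else 0) else bn r t m
def Qf (p : ℕ) (v : ℕ → ℤ) (m : ℕ → ℕ) : ℤ :=
  ∑ i ∈ range p, ((m i : ℤ)^2 - (if i = 0 then 0 else v i * m i + m i * m (i+1)))
def topv (a : ℕ) (v : ℕ → ℤ) (m : ℕ → ℕ) (i : ℕ) : ℤ := nb m i + v i + srcv a i
open Classical in
def wt (r : ℝ) (p a : ℕ) (v : ℕ → ℤ) (m : ℕ → ℕ) : ℝ :=
  if ∀ k, p ≤ k → m k = 0 then
    r ^ (Qf p v m) * ∏ i ∈ range p, fac r p i (topv a v m i) (m i) else 0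
def KK (r : ℝ) (p a : ℕ) (v : ℕ → ℤ) : ℝ := ∑' m : ℕ → ℕ, wt r p a v m

section
variable {r : ℝ} {p a : ℕ}

lemma srcv_nonneg (a i : ℕ) : 0 ≤ srcv a i := by unfold srcv; split_ifs <;> omega

lemma nb_nonneg (m : ℕ → ℕ) (i : ℕ) (hi : 1 ≤ i) : 0 ≤ nb m i := by
  unfold nb; split_ifs <;> omega

lemma bn_nonneg (h0 : 0 < r) (h1 : r < 1) (t : ℤ) (m : ℕ) : 0 ≤ bn r t m := by
  have hq0 : 0 < r^2 := by positivity
  have hq1 : r^2 < 1 := by nlinarith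
  unfold bn
  split_ifs
  · have := qPoch_pos hq0 hq1
    exact div_nonneg (this _).le (mul_nonneg (this _).le (this _).le)
  · exact le_rfl

lemma fac_nonneg (h0 : 0 < r) (h1 : r < 1) (i : ℕ) (t : ℤ) (m : ℕ) : 0 ≤ fac r p i t m := by
  unfold fac
  split_ifs
  · exact zero_le_one
  · exact le_rfl
  · exact bn_nonneg h0 h1 t m

lemma wt_nonneg (h0 : 0 < r) (h1 : r < 1) (v : ℕ → ℤ) (m : ℕ → ℕ) : 0 ≤ wt r p a v m := by
  unfold wt
  split_ifs
  · exact mul_nonneg (zpow_nonneg h0.le _) (prod_nonneg fun i _ => fac_nonneg h0 h1 _ _ _)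
  · exact le_rfl

/-- q-binomial Pascal rules, natural form -/
def gb (q : ℝ) (N m : ℕ) : ℝ := if m ≤ N then qPoch q N / (qPoch q m * qPoch q (N - m)) else 0

lemma gb_pascal1 {q : ℝ} (h0 : 0 < q) (h1 : q < 1) (N m : ℕ) :
    gb q (N+1) (m+1) = q^(m+1) * gb q N (m+1) + gb q N m := by
  unfold gb
  have hp := fun k => (qPoch_pos h0 h1 k).ne'
  rcases lt_trichotomy m N with h | h | h
  · obtain ⟨d, rfl⟩ : ∃ d, N = m + 1 + d := ⟨N - m - 1, by omega⟩
    rw [if_pos (by omega), if_pos (by omega), if_pos (by omega)]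
    rw [show m + 1 + d + 1 - (m+1) = d + 1 by omega, show m+1+d-(m+1) = d by omega,
      show m + 1 + d - m = d + 1 by omega, qPoch_succ q (m+1+d), qPoch_succ q d, qPoch_succ q m]
    have a1 := hp m
    have a2 := hp d
    have a3 := (one_sub_pow_pos h0 h1 d).ne'
    have a4 := (one_sub_pow_pos h0 h1 m).ne'
    field_simp
    ring
  · subst h
    rw [if_pos (by omega), if_neg (by omega), if_pos le_rfl]
    have a1 := hp m
    have a2 := hp (m+1)
    simp [qPoch_zero, a1, a2]
  · rw [if_neg (by omega), if_neg (by omega), if_neg (by omega)]; simp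

lemma gb_pascal2 {q : ℝ} (h0 : 0 < q) (h1 : q < 1) (N m : ℕ) :
    gb q (N+1) (m+1) = gb q N (m+1) + q^((N:ℤ)-m) * gb q N m := by
  unfold gb
  have hp := fun k => (qPoch_pos h0 h1 k).ne'
  rcases lt_trichotomy m N with h | h | h
  · obtain ⟨d, rfl⟩ : ∃ d, N = m + 1 + d := ⟨N - m - 1, by omega⟩
    rw [if_pos (by omega), if_pos (by omega), if_pos (by omega)]
    rw [show m + 1 + d + 1 - (m+1) = d + 1 by omega, show m+1+d-(m+1) = d by omega,
      show m + 1 + d - m = d + 1 by omega, qPoch_succ q (m+1+d), qPoch_succ q d, qPoch_succ q m]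
    have a1 := hp m
    have a2 := hp d
    have a3 := (one_sub_pow_pos h0 h1 d).ne'
    have a4 := (one_sub_pow_pos h0 h1 m).ne'
    have e : q^(((m+1+d : ℕ):ℤ) - m) = q^(d+1) := by
      rw [← zpow_natCast]; congr 1; push_cast; ring
    rw [e]
    field_simp
    ring
  · subst h
    rw [if_pos (by omega), if_neg (by omega), if_pos le_rfl]
    have a1 := hp m
    have a2 := hp (m+1)
    simp [qPoch_zero, a1, a2]
  · rw [if_neg (by omega), if_neg (by omega), if_neg (by omega)]; simp

lemma gb_zero {q : ℝ} (h0 : 0 < q) (h1 : q < 1) (N : ℕ) : gb q N 0 = 1 := by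
  unfold gb
  have := (qPoch_pos h0 h1 N).ne'
  simp [qPoch_zero, this]

lemma bn_even (N : ℕ) (m : ℕ) : bn r (2 * (N:ℤ)) m = gb (r^2) N m := by
  unfold bn gb
  have : (2 * (N:ℤ) / 2).toNat = N := by omega
  rw [this]
  congr 1
  simp

lemma bn_neg {t : ℤ} (ht : t < 0) (m : ℕ) : bn r t m = 0 := by
  unfold bn; rw [if_neg]; omega

lemma bn_odd {t : ℤ} (ht : ¬ Even t) (m : ℕ) : bn r t m = 0 := by
  unfold bn; rw [if_neg]; tauto

lemma bn_pascal1 (h0 : 0 < r) (h1 : r < 1) {t : ℤ} (ht : 1 ≤ t) (m : ℕ) :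
    bn r t m = r^(2*(m:ℤ)) * bn r (t-2) m + if 1 ≤ m then bn r (t-2) (m-1) else 0 := by
  have hq0 : 0 < r^2 := by positivity
  have hq1 : r^2 < 1 := by nlinarith
  by_cases he : Even t
  · obtain ⟨N, rfl⟩ : ∃ N : ℕ, t = 2 * ((N + 1 : ℕ) : ℤ) := by
      obtain ⟨k, hk⟩ := he
      exact ⟨(k-1).toNat, by push_cast; omega⟩
    rw [show 2 * ((N+1:ℕ):ℤ) - 2 = 2 * (N:ℤ) by push_cast; ring, bn_even, bn_even, bn_even]
    cases m with
    | zero => simp [gb_zero hq0 hq1]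
    | succ m =>
      simp only [le_add_iff_nonneg_left, zero_le, if_true, add_tsub_cancel_right]
      rw [gb_pascal1 hq0 hq1]
      congr 2
      rw [← pow_mul, ← zpow_natCast]; congr 1
  · have he' : ¬ Even (t-2) := by
      rw [Int.even_sub]; simp [he]
    simp [bn_odd he, bn_odd he']

lemma bn_pascal2 (h0 : 0 < r) (h1 : r < 1) {t : ℤ} (m : ℕ) (ht : ¬ (t = 0 ∧ m = 0)) :
    bn r t m = bn r (t-2) m + if 1 ≤ m then r^(t-2*(m:ℤ)) * bn r (t-2) (m-1) else 0 := by
  have hq0 : 0 < r^2 := by positivity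
  have hq1 : r^2 < 1 := by nlinarith
  by_cases he : Even t
  · rcases lt_trichotomy t 0 with h | h | h
    · rw [bn_neg h, bn_neg (by omega), bn_neg (by omega)]; simp
    · subst h
      rw [bn_neg (t := 0 - 2) (by omega), bn_neg (t := 0 - 2) (by omega)]
      unfold bn
      rw [if_neg (by omega)]; simp
    · obtain ⟨N, rfl⟩ : ∃ N : ℕ, t = 2 * ((N + 1 : ℕ) : ℤ) := by
        obtain ⟨k, hk⟩ := he
        exact ⟨(k-1).toNat, by push_cast; omega⟩
      rw [show 2 * ((N+1:ℕ):ℤ) - 2 = 2 * (N:ℤ) by push_cast; ring, bn_even, bn_even, bn_even]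
      cases m with
      | zero => simp [gb_zero hq0 hq1]
      | succ m =>
        simp only [le_add_iff_nonneg_left, zero_le, if_true, add_tsub_cancel_right]
        rw [gb_pascal2 hq0 hq1]
        congr 2
        have : (r^2)^((N:ℤ)-m) = r^(2*((N:ℤ)-m)) := by rw [zpow_mul]; norm_cast
        rw [this]; congr 1; push_cast; ring
  · have he' : ¬ Even (t-2) := by
      rw [Int.even_sub]; simp [he]
    simp [bn_odd he, bn_odd he']

lemma nb_add (m : ℕ → ℕ) (k i : ℕ) (hk : 1 ≤ k) :
    nb (sh k m) i = nb m i + colv k i := by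
  have hs : ∀ j, ((sh k m) j : ℤ) = m j + (if j = k then 1 else 0) := by
    intro j; unfold sh; split_ifs <;> simp
  unfold nb colv
  simp only [hs]
  split_ifs <;> omega

lemma nb_add0 (m : ℕ → ℕ) (i : ℕ) :
    nb (sh 0 m) i = nb m i + ev 2 i := by
  have hs : ∀ j, ((sh 0 m) j : ℤ) = m j + (if j = 0 then 1 else 0) := by
    intro j; unfold sh; split_ifs <;> simp
  unfold nb ev
  simp only [hs]
  rcases Nat.lt_or_ge i 3 with h | h
  · interval_cases i <;> simp
    ring
  · simp [show i ≠ 0 by omega, show i ≠ 1 by omega, show i ≠ 2 by omega, show i - 1 ≠ 0 by omega]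

lemma Qf_add (v v' : ℕ → ℤ) (m : ℕ → ℕ) (k : ℕ) (hk : 1 ≤ k) (hkp : k + 1 < p)
    (hv : ∀ i, v' i = v i - 2 * ev k i + colv k i) :
    Qf p v (sh k m) = Qf p v' m + (1 - v k) := by
  have hs : ∀ j, ((sh k m) j : ℤ) = m j + (if j = k then 1 else 0) := by
    intro j; unfold sh; split_ifs <;> simp
  unfold Qf
  have key : ∀ i ∈ range p, (((sh k m) i : ℤ)^2 - (if i = 0 then 0 else
      v i * ((sh k m) i : ℤ) + ((sh k m) i : ℤ) * ((sh k m) (i+1) : ℤ)))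
      = ((m i : ℤ)^2 - (if i = 0 then 0 else v' i * m i + m i * m (i+1)))
        + ((if i = k then (1 - v k - m (k+1)) else 0) + (if i = k + 1 then (m (k+1) : ℤ) else 0)) := by
    intro i _
    rw [hv, hs, hs]
    unfold ev colv
    rcases Nat.lt_trichotomy i k with h | h | h
    · by_cases h2 : i + 1 = k
      · by_cases hi : i = 0
        · simp [hi, show k ≠ 0 by omega, show 0 ≠ k by omega]
        · have : 2 ≤ k := by omega
          simp [h2, hi, this, show i ≠ k by omega, show i ≠ k + 1 by omega]
          ring
      · by_cases hi : i = 0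
        · simp [hi, show k ≠ 0 by omega, show 0 ≠ k by omega]
        · simp [h2, hi, show i ≠ k by omega, show i ≠ k + 1 by omega]
    · subst h
      simp [show i ≠ 0 by omega]
      ring
    · by_cases h2 : i = k + 1
      · subst h2
        simp [show k + 1 + 1 ≠ k by omega]
        ring
      · simp [h2, show i ≠ k by omega, show i + 1 ≠ k by omega, show i ≠ 0 by omega]
  rw [sum_congr rfl key, sum_add_distrib, sum_add_distrib, sum_ite_eq', sum_ite_eq',
    if_pos (mem_range.2 (by omega)), if_pos (mem_range.2 (by omega))]
  ring

lemma Qf_add0 (hp : 3 ≤ p) (v v' : ℕ → ℤ) (m : ℕ → ℕ)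
    (hv : ∀ i, v' i = v i - 2 * ev 0 i + ev 2 i) :
    Qf p v (sh 0 m) = Qf p v' m + (2 * m 0 + 1 + m 2) := by
  have hs : ∀ j, ((sh 0 m) j : ℤ) = m j + (if j = 0 then 1 else 0) := by
    intro j; unfold sh; split_ifs <;> simp
  unfold Qf
  have key : ∀ i ∈ range p, (((sh 0 m) i : ℤ)^2 - (if i = 0 then 0 else
      v i * ((sh 0 m) i : ℤ) + ((sh 0 m) i : ℤ) * ((sh 0 m) (i+1) : ℤ)))
      = ((m i : ℤ)^2 - (if i = 0 then 0 else v' i * m i + m i * m (i+1)))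
        + ((if i = 0 then (2 * m 0 + 1 : ℤ) else 0) + (if i = 2 then (m 2 : ℤ) else 0)) := by
    intro i _
    rw [hv, hs, hs]
    unfold ev
    by_cases h : i = 0
    · subst h; simp; ring
    · by_cases h2 : i = 2
      · subst h2; simp; ring
      · simp [h, h2]
  rw [sum_congr rfl key, sum_add_distrib, sum_add_distrib, sum_ite_eq', sum_ite_eq',
    if_pos (mem_range.2 (by omega)), if_pos (mem_range.2 (by omega))]

lemma Qf_sub (v v' : ℕ → ℤ) (m : ℕ → ℕ) (k : ℕ) (hk : 1 ≤ k) (hkp : k + 1 < p)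
    (hv : ∀ i, v' i = v i - 2 * ev k i) :
    Qf p v' m = Qf p v m + 2 * m k := by
  unfold Qf
  have key : ∀ i ∈ range p, ((m i : ℤ)^2 - (if i = 0 then 0 else v' i * m i + m i * m (i+1)))
      = ((m i : ℤ)^2 - (if i = 0 then 0 else v i * m i + m i * m (i+1)))
        + (if i = k then (2 * m k : ℤ) else 0) := by
    intro i _
    rw [hv]
    unfold ev
    by_cases h : i = k
    · subst h; simp [show i ≠ 0 by omega]; ring
    · simp [h]
  rw [sum_congr rfl key, sum_add_distrib, sum_ite_eq', if_pos (mem_range.2 (by omega))]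

lemma Qf_sub0 (v v' : ℕ → ℤ) (m : ℕ → ℕ) (hv : ∀ i, 1 ≤ i → v' i = v i) :
    Qf p v' m = Qf p v m := by
  unfold Qf
  refine sum_congr rfl fun i _ => ?_
  by_cases h : i = 0
  · simp [h]
  · rw [hv i (by omega)]

/-- splitting a sum by a shift -/
lemma shift_tsum (k : ℕ) (F f h : (ℕ → ℕ) → ℝ) (hf : Summable f) (hh : Summable h)
    (h1 : ∀ m, m k = 0 → F m = f m) (h2 : ∀ m, F (sh k m) = f (sh k m) + h m) :
    ∑' m, F m = ∑' m, f m + ∑' m, h m := by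
  have inj : Function.Injective (sh k) := by
    intro m m' h
    funext j
    have := congrFun h j
    simpa [sh] using this
  have hs : HasSum (fun m => F m - f m) (∑' m, h m) := by
    rw [← inj.hasSum_iff]
    · have : ((fun m => F m - f m) ∘ sh k) = h := by
        funext m; simp [h2]
      rw [this]; exact hh.hasSum
    · intro m hm
      have : m k = 0 := by
        by_contra hk
        apply hm
        refine ⟨fun j => m j - if j = k then 1 else 0, ?_⟩
        funext j
        by_cases hj : j = k
        · subst hj; simp [sh]; omega
        · simp [hj, sh]
      simp [h1 m this]
  have := hf.hasSum.add hs
  refine (hs_congr this ?_ rfl).tsum_eq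
  intro m; ring

lemma supp_add (m : ℕ → ℕ) (k : ℕ) (hk : k < p) :
    (∀ i, p ≤ i → (sh k m) i = 0) ↔ (∀ i, p ≤ i → m i = 0) := by
  refine forall_congr' fun i => ?_
  refine imp_congr_right fun hi => ?_
  simp [sh, show i ≠ k by omega]

lemma wt_split (v : ℕ → ℤ) (m : ℕ → ℕ) (k : ℕ) (hk : k + 1 < p) (hm : ∀ i, p ≤ i → m i = 0) :
    wt r p a v m = r ^ (Qf p v m) * (bn r (topv a v m k) (m k) *
      ∏ i ∈ (range p).erase k, fac r p i (topv a v m i) (m i)) := by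
  unfold wt
  rw [if_pos hm, ← mul_prod_erase (range p) _ (mem_range.2 (show k < p by omega))]
  congr 2
  unfold fac
  rw [if_neg (by omega)]

lemma wt_out (v : ℕ → ℤ) (m : ℕ → ℕ) (hm : ¬ ∀ i, p ≤ i → m i = 0) :
    wt r p a v m = 0 := by
  unfold wt; rw [if_neg hm]

end

section
variable {r : ℝ} {p a : ℕ}

lemma wt_ne {v : ℕ → ℤ} {m : ℕ → ℕ} (h : wt r p a v m ≠ 0) (hp : 2 ≤ p) :
    (∀ k, p - 1 ≤ k → m k = 0) ∧ (∀ i, i < p → Even (topv a v m i)) ∧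
    (∀ i, i < p - 1 → 2 * (m i : ℤ) ≤ topv a v m i) := by
  have hs : ∀ k, p ≤ k → m k = 0 := by
    by_contra hc; exact h (wt_out v m hc)
  unfold wt at h
  rw [if_pos hs] at h
  have hpr := right_ne_zero_of_mul h
  rw [prod_ne_zero_iff] at hpr
  have hlast := hpr (p-1) (mem_range.2 (by omega))
  unfold fac at hlast
  rw [if_pos rfl] at hlast
  have hl : m (p-1) = 0 ∧ Even (topv a v m (p-1)) := by
    by_contra hc; rw [if_neg hc] at hlast; exact hlast rfl
  have hb : ∀ i, i < p - 1 → Even (topv a v m i) ∧ 2 * (m i : ℤ) ≤ topv a v m i := by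
    intro i hi
    have := hpr i (mem_range.2 (by omega))
    unfold fac at this
    rw [if_neg (by omega)] at this
    unfold bn at this
    by_contra hc; rw [if_neg hc] at this; exact this rfl
  refine ⟨?_, ?_, fun i hi => (hb i hi).2⟩
  · intro k hk
    rcases Nat.lt_or_ge k p with h' | h'
    · have : k = p - 1 := by omega
      rw [this]; exact hl.1
    · exact hs k h'
  · intro i hi
    rcases Nat.lt_or_ge i (p-1) with h' | h'
    · exact (hb i h').1
    · have : i = p - 1 := by omega
      rw [this]; exact hl.2

lemma nb_ge3 (m : ℕ → ℕ) (i : ℕ) (hi : 3 ≤ i) : nb m i = m (i-1) + m (i+1) := by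
  unfold nb
  rw [if_neg (by omega), if_neg (by omega), if_neg (by omega)]

lemma wt_bound (hp : 4 ≤ p) (v : ℕ → ℤ) : ∃ M : ℕ, ∀ m, wt r p a v m ≠ 0 → ∀ i, m i ≤ M := by
  obtain ⟨B, hB⟩ : ∃ B : ℕ, ∀ i, i < p → v i + srcv a i ≤ B := by
    refine ⟨∑ i ∈ range p, (v i + srcv a i).toNat, fun i hi => ?_⟩
    have : (v i + srcv a i).toNat ≤ ∑ i ∈ range p, (v i + srcv a i).toNat :=
      single_le_sum (f := fun i => (v i + srcv a i).toNat) (fun _ _ => Nat.zero_le _)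
        (mem_range.2 hi)
    omega
  refine ⟨B + p * (p * B), fun m hm => ?_⟩
  obtain ⟨h1, _, h3⟩ := wt_ne hm (by omega)
  have step : ∀ n, ∀ i, 3 ≤ i → i + n = p - 1 → m i ≤ m (i-1) + n * B := by
    intro n
    induction n with
    | zero => intro i _ hi; rw [h1 i (by omega)]; omega
    | succ n ih =>
      intro i hi hn
      have e := ih (i+1) (by omega) (by omega)
      have f := h3 i (by omega)
      unfold topv at f
      rw [nb_ge3 m i hi] at f
      have g := hB i (by omega)
      rw [add_tsub_cancel_right] at e
      rw [add_mul]
      omega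
  have h0 : m 2 ≤ B ∧ m 0 ≤ B := by
    have f := h3 0 (by omega)
    have g := hB 0 (by omega)
    unfold topv nb at f
    simp at f
    omega
  have h1' : m 1 ≤ B := by
    have f := h3 1 (by omega)
    have g := hB 1 (by omega)
    unfold topv nb at f
    simp at f
    omega
  have up : ∀ i, 2 ≤ i → i ≤ p - 1 → m i ≤ B + i * (p * B) := by
    intro i hi
    induction i, hi using Nat.le_induction with
    | base => intro _; omega
    | succ i hi ih =>
      intro hi2
      have e := ih (by omega)
      have f := step (p - 1 - (i+1)) (i+1) (by omega) (by omega)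
      rw [add_tsub_cancel_right] at f
      have : (p - 1 - (i+1)) * B ≤ p * B := Nat.mul_le_mul_right _ (by omega)
      rw [add_mul]
      omega
  intro i
  rcases Nat.lt_or_ge i 2 with hi | hi
  · interval_cases i
    · omega
    · omega
  · rcases Nat.lt_or_ge i (p-1) with hi2 | hi2
    · have e := up i hi (by omega)
      have : i * (p * B) ≤ p * (p * B) := Nat.mul_le_mul_right _ (by omega)
      omega
    · rw [h1 i hi2]; omega

lemma fin_set (p M : ℕ) : {m : ℕ → ℕ | (∀ i, m i ≤ M) ∧ ∀ i, p ≤ i → m i = 0}.Finite := by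
  apply Set.Finite.of_finite_image (f := fun (m : ℕ → ℕ) (i : Fin p) => m i)
  · apply (Set.Finite.pi (t := fun _ : Fin p => Set.Iic M) (fun _ => Set.finite_Iic M)).subset
    rintro _ ⟨m, hm, rfl⟩
    intro i _
    exact hm.1 i
  · intro m hm m' hm' h
    funext i
    rcases Nat.lt_or_ge i p with hi | hi
    · exact congrFun h ⟨i, hi⟩
    · rw [hm.2 i hi, hm'.2 i hi]

lemma wt_summ (hp : 4 ≤ p) (v : ℕ → ℤ) : Summable (wt r p a v) := by
  apply summable_of_hasFiniteSupport
  obtain ⟨M, hM⟩ := wt_bound (r := r) (a := a) hp v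
  apply (fin_set p M).subset
  intro m hm
  exact ⟨hM m hm, fun i hi => (wt_ne hm (by omega)).1 i (by omega)⟩

lemma KK_congr {v v' : ℕ → ℤ} (h : ∀ i, v i = v' i) : KK r p a v = KK r p a v' := by
  rw [funext h]

lemma KK_neg (hp : 4 ≤ p) {v : ℕ → ℤ} (h : v 0 < 0) : KK r p a v = 0 := by
  unfold KK
  have : ∀ m, wt r p a v m = 0 := by
    intro m
    by_contra hm
    have f := (wt_ne hm (by omega)).2.2 0 (by omega)
    unfold topv nb srcv at f
    simp at f
    omega
  simp [this]

lemma prod_congr_top (v v' : ℕ → ℤ) (m m' : ℕ → ℕ) (k : ℕ)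
    (h : ∀ i, i ≠ k → topv a v m i = topv a v' m' i) (hm : ∀ i, i ≠ k → m i = m' i) :
    ∏ i ∈ (range p).erase k, fac r p i (topv a v m i) (m i)
      = ∏ i ∈ (range p).erase k, fac r p i (topv a v' m' i) (m' i) := by
  refine prod_congr rfl fun i hi => ?_
  have := ne_of_mem_erase hi
  rw [h i this, hm i this]

lemma colv_self (k : ℕ) : colv k k = 0 := by
  unfold colv
  rw [if_neg (by omega), if_neg (by omega), if_neg (by omega)]; rfl

lemma sh_ne (m : ℕ → ℕ) {k i : ℕ} (h : i ≠ k) : sh k m i = m i := by simp [sh, h]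
lemma sh_self (m : ℕ → ℕ) (k : ℕ) : sh k m k = m k + 1 := by simp [sh]

/-- node recursion -/
lemma LR (h0 : 0 < r) (h1 : r < 1) (hp : 4 ≤ p) (k : ℕ) (hk : 1 ≤ k) (hkp : k + 1 < p)
    (v v1 v2 : ℕ → ℤ) (hs : 1 ≤ v k + srcv a k) (e1 : ∀ i, v1 i = v i - 2 * ev k i)
    (e2 : ∀ i, v2 i = v i - 2 * ev k i + colv k i) :
    KK r p a v = KK r p a v1 + r^(1 - v k) * KK r p a v2 := by
  unfold KK
  rw [← tsum_mul_left]
  have ek : ev k k = 1 := by simp [ev]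
  have en : ∀ i, i ≠ k → ev k i = 0 := by intro i hi; simp [ev, hi]
  have main : ∀ m : ℕ → ℕ, (∀ i, p ≤ i → m i = 0) →
      wt r p a v m = wt r p a v1 m + if 1 ≤ m k then r^(Qf p v m) * (bn r (topv a v m k - 2) (m k - 1)
        * ∏ i ∈ (range p).erase k, fac r p i (topv a v m i) (m i)) else 0 := by
    intro m hm
    rw [wt_split v m k hkp hm, wt_split v1 m k hkp hm]
    have ht : 1 ≤ topv a v m k := by
      have := nb_nonneg m k hk
      unfold topv; omega
    rw [bn_pascal1 h0 h1 ht]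
    have t1 : topv a v1 m k = topv a v m k - 2 := by unfold topv; rw [e1, ek]; ring
    rw [prod_congr_top v1 v m m k
      (by intro i hi; unfold topv; rw [e1, en i hi]; ring) (fun _ _ => rfl), t1,
      Qf_sub v v1 m k hk hkp e1, zpow_add₀ h0.ne']
    split_ifs <;> ring
  apply shift_tsum k
  · exact wt_summ hp v1
  · exact (wt_summ hp v2).mul_left _
  · intro m hm
    by_cases hsu : ∀ i, p ≤ i → m i = 0
    · rw [main m hsu, if_neg (by omega), add_zero]
    · rw [wt_out v m hsu, wt_out v1 m hsu]
  · intro m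
    by_cases hsu : ∀ i, p ≤ i → m i = 0
    · rw [main (sh k m) ((supp_add m k (by omega)).2 hsu), if_pos (by rw [sh_self]; omega)]
      congr 1
      rw [wt_split v2 m k hkp hsu, Qf_add v v2 m k hk hkp e2, zpow_add₀ h0.ne', sh_self,
        add_tsub_cancel_right]
      rw [prod_congr_top v2 v m (sh k m) k
        (by intro i hi; unfold topv; rw [nb_add m k i hk, e2, en i hi]; ring)
        (fun i hi => (sh_ne m hi).symm)]
      have t1 : topv a v2 m k = topv a v (sh k m) k - 2 := by
        unfold topv; rw [nb_add m k k hk, e2, ek, colv_self]; ring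
      rw [t1]; ring
    · rw [wt_out v2 m hsu, wt_out v _ (fun h => hsu ((supp_add m k (by omega)).1 h)),
        wt_out v1 _ (fun h => hsu ((supp_add m k (by omega)).1 h))]; simp

/-- node recursion at the node zero -/
lemma N0 (h0 : 0 < r) (h1 : r < 1) (hp : 4 ≤ p)
    (v v1 v2 : ℕ → ℤ) (hz : ∀ m, wt r p a v m ≠ 0 → m 0 = 0 → (m 2 : ℤ) ≠ v 0)
    (hsrc : srcv a 0 = 0)
    (e1 : ∀ i, v1 i = v i - 2 * ev 0 i)
    (e2 : ∀ i, v2 i = v i - 2 * ev 0 i + ev 2 i) :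
    KK r p a v = KK r p a v1 + r^(v 0 - 1) * KK r p a v2 := by
  unfold KK
  rw [← tsum_mul_left]
  have ek : ev 0 0 = 1 := by simp [ev]
  have en : ∀ i, i ≠ 0 → ev 0 i = 0 := by intro i hi; simp [ev, hi]
  have t0 : ∀ (w : ℕ → ℤ) (m : ℕ → ℕ), topv a w m 0 = w 0 - m 2 := by
    intro w m; unfold topv nb; rw [hsrc]; simp; ring
  have prc : ∀ m, ∏ i ∈ (range p).erase 0, fac r p i (topv a v1 m i) (m i)
      = ∏ i ∈ (range p).erase 0, fac r p i (topv a v m i) (m i) := fun m =>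
    prod_congr_top v1 v m m 0
      (by intro i hi; unfold topv; rw [e1, en i hi]; ring) (fun _ _ => rfl)
  have qe : ∀ m, Qf p v1 m = Qf p v m := fun m => by
    apply Qf_sub0
    intro i hi; rw [e1, en i (by omega)]; ring
  have main : ∀ m : ℕ → ℕ, (∀ i, p ≤ i → m i = 0) →
      wt r p a v m = wt r p a v1 m + if 1 ≤ m 0 then r^(Qf p v m) *
        (r^(v 0 - m 2 - 2 * (m 0 : ℤ)) * bn r (v 0 - m 2 - 2) (m 0 - 1)
        * ∏ i ∈ (range p).erase 0, fac r p i (topv a v m i) (m i)) else 0 := by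
    intro m hm
    have hv1 : v1 0 = v 0 - 2 := by rw [e1, ek]; ring
    by_cases hc : v 0 - m 2 = 0 ∧ m 0 = 0
    · have hw : wt r p a v m = 0 := by
        by_contra hw
        exact hz m hw hc.2 (by omega)
      rw [hw, wt_split v1 m 0 (by omega) hm, t0, bn_neg (by omega), if_neg (by omega)]
      simp
    rw [wt_split v m 0 (by omega) hm, wt_split v1 m 0 (by omega) hm, t0, t0]
    rw [bn_pascal2 h0 h1 _ hc]
    rw [prc, hv1, qe, show v 0 - 2 - (m 2 : ℤ) = v 0 - m 2 - 2 by ring]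
    split_ifs <;> ring
  apply shift_tsum 0
  · exact wt_summ hp v1
  · exact (wt_summ hp v2).mul_left _
  · intro m hm
    by_cases hsu : ∀ i, p ≤ i → m i = 0
    · rw [main m hsu, if_neg (by omega), add_zero]
    · rw [wt_out v m hsu, wt_out v1 m hsu]
  · intro m
    by_cases hsu : ∀ i, p ≤ i → m i = 0
    · rw [main (sh 0 m) ((supp_add m 0 (by omega)).2 hsu), if_pos (by rw [sh_self]; omega)]
      congr 1
      rw [wt_split v2 m 0 (by omega) hsu, Qf_add0 (by omega) v v2 m e2, sh_self,
        add_tsub_cancel_right, sh_ne m (show 2 ≠ 0 by omega)]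
      rw [prod_congr_top v2 v m (sh 0 m) 0
        (by intro i hi; unfold topv; rw [nb_add0, e2, en i hi]; ring)
        (fun i hi => (sh_ne m hi).symm)]
      have t1 : topv a v2 m 0 = v 0 - m 2 - 2 := by
        rw [t0, e2, ek]; simp [ev]; ring
      rw [t1]
      have : r^(v 0 - 1) * r^(Qf p v2 m) = r^(Qf p v2 m + (2 * m 0 + 1 + m 2)) *
          r^(v 0 - m 2 - 2 * ((m 0 + 1 : ℕ) : ℤ)) := by
        simp only [← zpow_add₀ h0.ne']; congr 1; push_cast; ring
      rw [← mul_assoc (r^(v 0 - 1)), this]; ring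
    · rw [wt_out v2 m hsu, wt_out v _ (fun h => hsu ((supp_add m 0 (by omega)).1 h)),
        wt_out v1 _ (fun h => hsu ((supp_add m 0 (by omega)).1 h))]; simp

lemma mono_seg {f : ℕ → ℤ} {l n : ℕ} (h : ∀ i, l ≤ i → i < n → f i ≤ f (i+1)) :
    ∀ i j, l ≤ i → i ≤ j → j ≤ n → f i ≤ f j := by
  intro i j hi hij
  induction j, hij using Nat.le_induction with
  | base => intro _; exact le_rfl
  | succ j hj ih => intro hn; exact (ih (by omega)).trans (h j (by omega) (by omega))

lemma anti_seg {f : ℕ → ℤ} {l n : ℕ} (h : ∀ i, l ≤ i → i < n → f (i+1) ≤ f i) :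
    ∀ i j, l ≤ i → i ≤ j → j ≤ n → f j ≤ f i := by
  intro i j h1 h2 h3
  have := mono_seg (f := fun i => - f i) (l := l) (n := n) (by intro i a b; simpa using h i a b)
    i j h1 h2 h3
  simpa using this

/-- second part of Lemma Z -/
lemma Z_low {y : ℕ → ℤ} {c c' : ℕ} (hy : ∀ i, 0 ≤ y i) (y0 : y 0 = 0) (yc : y c = 0) (hc : c' ≤ c)
    (hd : ∀ i, i + 1 < c → 2 * y (i+1) ≤ y i + y (i+2) + ev c' (i+1)) :
    ∀ i, i ≤ c → y i = 0 := by
  have fin : (∀ i, i < c → y (i+1) ≤ y i) → ∀ i, i ≤ c → y i = 0 := by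
    intro h i hi
    have := anti_seg (f := y) (l := 0) (n := c) (fun i _ hi => h i hi) 0 i le_rfl (by omega) hi
    have := hy i
    omega
  rcases Nat.eq_zero_or_pos c with h | hpos
  · intro i hi
    have : i = 0 := by omega
    rw [this, y0]
  set d : ℕ → ℤ := fun i => y (i+1) - y i with hdd
  have dlast : d (c-1) ≤ 0 := by
    simp only [hdd]
    rw [show c - 1 + 1 = c by omega, yc]
    have := hy (c-1); omega
  have dstep : ∀ i, i + 1 < c → d i ≤ d (i+1) + ev c' (i+1) := by
    intro i hi
    have := hd i hi
    simp only [hdd]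
    rw [show i + 1 + 1 = i + 2 by omega]
    omega
  have dhigh : ∀ i, c' ≤ i → i < c → d i ≤ 0 := by
    intro i h1 h2
    have := mono_seg (f := d) (l := c') (n := c - 1) (by
      intro j h3 h4
      have := dstep j (by omega)
      unfold ev at this
      rw [if_neg (by omega)] at this
      omega) i (c-1) h1 (by omega) le_rfl
    omega
  have dlow : ∀ i j, i ≤ j → j + 1 ≤ c' → j < c → d i ≤ d j := by
    intro i j h1 h2 h4
    exact mono_seg (f := d) (l := 0) (n := j) (by
      intro k _ h3
      have := dstep k (by omega)
      unfold ev at this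
      rw [if_neg (by omega)] at this
      omega) i j (by omega) h1 le_rfl
  rcases Nat.lt_or_ge c' c with hlt | hge
  · by_cases hneg : d c' ≤ -1
    · apply fin
      intro i hi
      have key : d i ≤ 0 := by
        rcases Nat.lt_or_ge i c' with h' | h'
        · have e1 := dlow i (c'-1) (by omega) (by omega) (by omega)
          have e2 := dstep (c'-1) (by omega)
          rw [show c' - 1 + 1 = c' by omega] at e2
          unfold ev at e2
          rw [if_pos rfl] at e2
          omega
        · exact dhigh i h' hi
      simp only [hdd] at key; omega
    · have up : ∀ i, c' ≤ i → i < c → y i ≤ y (i+1) := by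
        intro i h1 h2
        have := mono_seg (f := d) (l := c') (n := c - 1) (by
          intro j h3 h4
          have := dstep j (by omega)
          unfold ev at this
          rw [if_neg (by omega)] at this
          omega) c' i le_rfl h1 (by omega)
        have : 0 ≤ d i := by omega
        simp only [hdd] at this; omega
      have hz : ∀ i, c' ≤ i → i ≤ c → y i = 0 := by
        intro i h1 h2
        have := mono_seg (f := y) (l := c') (n := c) up i c h1 h2 le_rfl
        have := hy i
        omega
      apply fin
      intro i hi
      rcases Nat.lt_or_ge i c' with h' | h'
      · have e1 := dlow i (c'-1) (by omega) (by omega) (by omega)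
        simp only [hdd] at e1
        rw [show c' - 1 + 1 = c' by omega, hz c' le_rfl hc] at e1
        have := hy (c'-1)
        omega
      · rw [hz i h' (by omega), hz (i+1) (by omega) (by omega)]
  · apply fin
    intro i hi
    have e1 := dlow i (c-1) (by omega) (by omega) (by omega)
    simp only [hdd] at e1 dlast
    omega

lemma Z_main {y : ℕ → ℤ} {c c' n : ℕ} (hy : ∀ i, 0 ≤ y i) (y0 : y 0 = 0) (yn : y n = 0)
    (hc : c' ≤ c) (hcn : c < n)
    (hd : ∀ i, i + 1 < n → 2 * y (i+1) ≤ y i + y (i+2) + ev c (i+1) + ev c' (i+1))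
    (hev : Even (y (n-1))) (hev2 : ∀ i, c ≤ i → i + 2 ≤ n → Even (y i + y (i+2))) :
    ∀ i, i ≤ n → y i = 0 := by
  have evens : ∀ k i, c ≤ i → i + k = n → Even (y i) := by
    intro k
    induction k using Nat.strong_induction_on with
    | _ k ih =>
      intro i hi hk
      match k, ih with
      | 0, _ => rw [show i = n by omega, yn]; exact Even.zero
      | 1, _ => rw [show i = n - 1 by omega]; exact hev
      | k+2, ih =>
        have e1 := ih k (by omega) (i+2) (by omega) (by omega)
        have e2 := hev2 i hi (by omega)
        have := e2.sub e1
        simpa using this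
  set d : ℕ → ℤ := fun i => y (i+1) - y i with hdd
  have dstep : ∀ i, i + 1 < n → d i ≤ d (i+1) + ev c (i+1) + ev c' (i+1) := by
    intro i hi
    have := hd i hi
    simp only [hdd]
    rw [show i + 1 + 1 = i + 2 by omega]
    omega
  have dmono : ∀ i, c ≤ i → i < n - 1 → d i ≤ d (i+1) := by
    intro i h1 h2
    have := dstep i (by omega)
    unfold ev at this
    rw [if_neg (by omega), if_neg (by omega)] at this
    omega
  have dlast : d (n-1) ≤ 0 := by
    simp only [hdd]
    rw [show n - 1 + 1 = n by omega, yn]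
    have := hy (n-1); omega
  have dc : d c ≤ 0 := by
    have := mono_seg dmono c (n-1) le_rfl (by omega) le_rfl
    omega
  have dce : Even (d c) := by
    exact (evens (n - (c+1)) (c+1) (by omega) (by omega)).sub (evens (n-c) c le_rfl (by omega))
  have dc0 : d c = 0 := by
    by_contra hne
    have h2 : d c ≤ -2 := by
      obtain ⟨k, hk⟩ := dce; omega
    have low : ∀ i, i < c → y (i+1) ≤ y i := by
      intro i hi
      have := mono_seg (f := fun i => d i - (if i < c then 1 else 0) - (if i < c' then 1 else 0))
        (l := 0) (n := c) (by
          intro j _ h4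
          have := dstep j (by omega)
          unfold ev at this
          split_ifs at this ⊢ <;> omega) i c (by omega) (by omega) le_rfl
      have key : d i ≤ 0 := by split_ifs at this <;> omega
      simp only [hdd] at key; omega
    have := anti_seg (f := y) (l := 0) (n := c) (fun i _ hi => low i hi) 0 c le_rfl (by omega) le_rfl
    have h3 := hy (c+1)
    simp only [hdd] at h2
    omega
  have high : ∀ i, c ≤ i → i ≤ n → y i = 0 := by
    have up : ∀ i, c ≤ i → i < n → y i ≤ y (i+1) := by
      intro i h1 h2
      have := mono_seg dmono c i le_rfl h1 (by omega)
      have : 0 ≤ d i := by omega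
      simp only [hdd] at this; omega
    intro i h1 h2
    have := mono_seg up i n h1 h2 le_rfl
    have := hy i
    omega
  have low := Z_low hy y0 (high c le_rfl hcn.le) hc (by
    intro i hi
    have := hd i (by omega)
    have e : ev c (i+1) = 0 := by unfold ev; rw [if_neg (by omega)]
    omega)
  intro i hi
  rcases Nat.lt_or_ge i c with h | h
  · exact low i h.le
  · exact high i h hi
end

section
variable {r : ℝ} {p a : ℕ}

lemma colv2 (i : ℕ) : colv 2 i = ev 1 i + ev 3 i - ev 0 i := by
  unfold colv ev
  rcases Nat.lt_or_ge i 4 with h | h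
  · interval_cases i <;> norm_num
  · simp [show i ≠ 0 by omega, show i ≠ 1 by omega, show i ≠ 3 by omega]

lemma nb_zero_of (m : ℕ → ℕ) (h : m 0 = 0) (i : ℕ) : nb m (i+1) = m i + m (i+2) := by
  unfold nb
  rcases Nat.lt_or_ge i 2 with hi | hi
  · interval_cases i <;> simp [h]
  · simp [show i ≠ 0 by omega, show i ≠ 1 by omega]

lemma wt_Z (hp : 4 ≤ p) (ha : a ≤ p - 2) {v : ℕ → ℤ} {m : ℕ → ℕ} (h : wt r p a v m ≠ 0)
    (m0 : m 0 = 0) (b : ℕ) (hb : b ≤ p - 1) (hv : ∀ i, 1 ≤ i → v i ≤ ev b i)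
    (hv0 : ∀ i, b < i → v i = 0) : ∀ i, m i = 0 := by
  obtain ⟨z1, z2, z3⟩ := wt_ne h (by omega)
  have hd : ∀ i, i + 1 < p - 1 → 2 * (m (i+1) : ℤ) ≤ m i + m (i+2) + ev a (i+1) + ev b (i+1) := by
    intro i hi
    have e1 := z3 (i+1) hi
    unfold topv at e1
    rw [nb_zero_of m m0] at e1
    have e2 := hv (i+1) (by omega)
    have e3 : srcv a (i+1) ≤ ev a (i+1) := by unfold srcv ev; split_ifs <;> omega
    omega
  have fin : (∀ i, i ≤ p - 1 → (m i : ℤ) = 0) → ∀ i, m i = 0 := by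
    intro h i
    rcases Nat.lt_or_ge i p with hi | hi
    · have := h i (by omega); omega
    · exact z1 i (by omega)
  apply fin
  by_cases hbp : b = p - 1
  · apply Z_low (y := fun i => (m i : ℤ)) (c := p - 1) (c' := a) (fun i => by positivity)
      (by simp [m0]) (by simp [z1 (p-1) le_rfl]) (by omega)
    intro i hi
    have := hd i hi
    have e : ev b (i+1) = 0 := by unfold ev; rw [if_neg (by omega)]
    rw [e] at this
    simpa using this
  · have par : ∀ i, max a b ≤ i → i + 1 < p → Even ((m i : ℤ) + m (i+2)) := by
      intro i h1 h2
      have e1 := z2 (i+1) h2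
      unfold topv at e1
      rw [nb_zero_of m m0, hv0 (i+1) (by omega)] at e1
      have : srcv a (i+1) = 0 := by unfold srcv; rw [if_neg (by omega)]
      simpa [this] using e1
    apply Z_main (y := fun i => (m i : ℤ)) (c := max a b) (c' := min a b) (n := p - 1)
      (fun i => by positivity) (by simp [m0]) (by simp [z1 (p-1) le_rfl]) (by omega) (by omega)
    · intro i hi
      have := hd i hi
      have e : ev (max a b) (i+1) + ev (min a b) (i+1) = ev a (i+1) + ev b (i+1) := by
        rcases le_total a b with h | h
        · rw [max_eq_right h, min_eq_left h]; ring
        · rw [max_eq_left h, min_eq_right h]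
      omega
    · have := par (p - 1 - 1) (by omega) (by omega)
      rw [z1 (p-1-1+2) (by omega)] at this
      simpa using this
    · intro i h1 h2
      exact par i h1 (by omega)

lemma bn_zero (h0 : 0 < r) (h1 : r < 1) {t : ℤ} (ht : 0 ≤ t) (he : Even t) : bn r t 0 = 1 := by
  have hq0 : 0 < r^2 := by positivity
  have hq1 : r^2 < 1 := by nlinarith
  obtain ⟨k, hk⟩ := he
  rw [show t = 2 * (k.toNat : ℤ) by omega, bn_even, gb_zero hq0 hq1]

lemma nb_zero (i : ℕ) : nb (fun _ => 0) i = 0 := by unfold nb; split_ifs <;> simp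

lemma wt_zero (h0 : 0 < r) (h1 : r < 1) (v : ℕ → ℤ)
    (h : ∀ i, i < p → Even (v i + srcv a i) ∧ 0 ≤ v i + srcv a i) :
    wt r p a v (fun _ => 0) = 1 := by
  unfold wt
  rw [if_pos (fun _ _ => rfl)]
  have e1 : Qf p v (fun _ => 0) = 0 := by unfold Qf; simp
  rw [e1, zpow_zero, one_mul]
  apply prod_eq_one
  intro i hi
  have := h i (mem_range.1 hi)
  unfold topv fac
  rw [nb_zero, zero_add, bn_zero h0 h1 this.2 this.1]
  simp [this.1]

lemma wt_zero' (hp : 4 ≤ p) (v : ℕ → ℤ) (i : ℕ) (hi : i < p) (h : ¬ Even (v i + srcv a i)) :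
    wt r p a v (fun _ => 0) = 0 := by
  by_contra hc
  have := (wt_ne hc (by omega)).2.1 i hi
  unfold topv at this
  rw [nb_zero, zero_add] at this
  exact h this

lemma KK_base (hp : 4 ≤ p) (ha : a ≤ p - 2) {v : ℕ → ℤ}
    (b : ℕ) (hb : b ≤ p - 1) (hv : ∀ i, 1 ≤ i → v i ≤ ev b i)
    (hv0 : ∀ i, b < i → v i = 0) (h0 : v 0 = 0) : KK r p a v = wt r p a v (fun _ => 0) := by
  unfold KK
  apply tsum_eq_single
  intro m hm
  by_contra hc
  apply hm
  have m0 : m 0 = 0 := by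
    have := (wt_ne hc (by omega)).2.2 0 (by omega)
    unfold topv nb srcv at this
    simp [h0] at this
    split_ifs at this <;> omega
  funext i
  exact wt_Z hp ha hc m0 b hb hv hv0 i

/-- zero-node recursion with Lemma Z built in -/
lemma N0Z (h0 : 0 < r) (h1 : r < 1) (hp : 4 ≤ p) (ha : a ≤ p - 2) 
    (v v1 v2 : ℕ → ℤ) (b : ℕ) (hb : b ≤ p - 1) (hv : ∀ i, 1 ≤ i → v i ≤ ev b i)
    (hv0 : ∀ i, b < i → v i = 0)
    (hz : v 0 ≠ 0 ∨ ∃ i, i < p ∧ ¬ Even (v i + srcv a i)) (l : ℤ) (hl : v 0 = l)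
    (e1 : ∀ i, v1 i = v i - 2 * ev 0 i)
    (e2 : ∀ i, v2 i = v i - 2 * ev 0 i + ev 2 i) :
    KK r p a v = KK r p a v1 + r^(l - 1) * KK r p a v2 := by
  rw [← hl]
  apply N0 h0 h1 hp v v1 v2 _ _ e1 e2
  · intro m hm m0 m2
    have z := wt_Z hp ha hm m0 b hb hv hv0
    rcases hz with hz | ⟨i, hi, hz⟩
    · rw [z 2] at m2; exact hz (by simpa using m2.symm)
    · have : m = fun _ => 0 := funext z
      rw [this] at hm
      exact hm (wt_zero' hp v i hi hz)
  · unfold srcv; split_ifs <;> omega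

lemma LR1 (h0 : 0 < r) (h1 : r < 1) (hp : 4 ≤ p) (k : ℕ) (hk : 1 ≤ k) (hkp : k + 1 < p)
    (v v1 v2 : ℕ → ℤ) (hs : v k = 1) (e1 : ∀ i, v1 i = v i - 2 * ev k i)
    (e2 : ∀ i, v2 i = v i - 2 * ev k i + colv k i) :
    KK r p a v = KK r p a v1 + KK r p a v2 := by
  have := LR (a := a) h0 h1 hp k hk hkp v v1 v2 (by have := srcv_nonneg a k; omega) e1 e2
  rw [this, hs]; simp

lemma LR2 (h0 : 0 < r) (h1 : r < 1) (hp : 4 ≤ p) (k : ℕ) (hk : 1 ≤ k) (hkp : k + 1 < p)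
    (v v1 v2 : ℕ → ℤ) (hs : v k = 2) (e1 : ∀ i, v1 i = v i - 2 * ev k i)
    (e2 : ∀ i, v2 i = v i - 2 * ev k i + colv k i) :
    KK r p a v = KK r p a v1 + r⁻¹ * KK r p a v2 := by
  have := LR (a := a) h0 h1 hp k hk hkp v v1 v2 (by have := srcv_nonneg a k; omega) e1 e2
  rw [this, hs]; norm_num

lemma KK_par (hp : 4 ≤ p) (v v1 : ℕ → ℤ) (e1 : ∀ i, v1 i = v i - 2 * ev (p-1) i) :
    KK r p a v = KK r p a v1 := by
  unfold KK
  congr 1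
  funext m
  have en : ∀ i, i ≠ p - 1 → v1 i = v i := by intro i hi; rw [e1]; simp [ev, hi]
  have ek : v1 (p-1) = v (p-1) - 2 := by rw [e1]; simp [ev]
  have hpe : (Even (topv a v m (p-1)) ↔ Even (topv a v1 m (p-1))) := by
    unfold topv; rw [ek]
    rw [show nb m (p-1) + (v (p-1) - 2) + srcv a (p-1)
      = nb m (p-1) + v (p-1) + srcv a (p-1) - 2 by ring, Int.even_sub]
    simp
  have key : ∀ i ∈ range p, fac r p i (topv a v m i) (m i) = fac r p i (topv a v1 m i) (m i) := by
    intro i hi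
    by_cases h : i = p - 1
    · subst h
      unfold fac
      rw [if_pos rfl, if_pos rfl]
      simp only [hpe]
    · have : topv a v m i = topv a v1 m i := by unfold topv; rw [en i h]
      rw [this]
  unfold wt
  rw [prod_congr rfl key]
  by_cases hm : m (p-1) = 0
  · have : Qf p v m = Qf p v1 m := by
      unfold Qf
      refine sum_congr rfl fun i _ => ?_
      by_cases h : i = p - 1
      · subst h; simp [hm]
      · rw [en i h]
    rw [this]
  · have : ∏ i ∈ range p, fac r p i (topv a v1 m i) (m i) = 0 := by
      apply prod_eq_zero (mem_range.2 (show p - 1 < p by omega))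
      unfold fac
      rw [if_pos rfl, if_neg (by tauto)]
    rw [this]; simp

lemma tele_U (h0 : 0 < r) (h1 : r < 1) (hp : 4 ≤ p) (s : ℕ → ℤ) (b : ℕ) (hb : 3 ≤ b) :
    b ≤ p - 1 → (∀ k, 3 ≤ k → k < b → s k = 0) →
    KK r p a (fun i => s i - ev 2 i + ev 3 i) =
      ∑ k ∈ Ico 2 (b-1), KK r p a (fun i => s i - ev k i - ev (k+1) i)
        + KK r p a (fun i => s i - ev (b-1) i + ev b i) := by
  induction b, hb using Nat.le_induction with
  | base => intro _ _; simp
  | succ b hb ih =>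
    intro hbp hs
    rw [ih (by omega) (fun k h3 h4 => hs k h3 (by omega))]
    have e := LR1 (a := a) h0 h1 hp b (by omega) (by omega) (fun i => s i - ev (b-1) i + ev b i)
      (fun i => s i - ev (b-1) i - ev b i) (fun i => s i - ev b i + ev (b+1) i)
      (by simp [ev, hs b hb (by omega), show b ≠ b - 1 by omega])
      (by intro i; ring)
      (by intro i; simp only [ev, colv]; split_ifs <;> omega)
    rw [e, show b + 1 - 1 = (b - 1) + 1 by omega, sum_Ico_succ_top (by omega),
      show b - 1 + 1 = b by omega]
    ring

lemma tele_D (h0 : 0 < r) (h1 : r < 1) (hp : 4 ≤ p) (s : ℕ → ℤ) (b : ℕ) (hb : 3 ≤ b) :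
    b ≤ p - 1 → (∀ k, 2 ≤ k → k < b → s k = 0) →
    KK r p a (fun i => s i + ev (b-1) i - ev b i) =
      ∑ k ∈ Ico 2 b, KK r p a (fun i => s i - ev k i - ev (k+1) i)
        + KK r p a (fun i => s i + ev 1 i - ev 2 i - ev 0 i) := by
  induction b, hb using Nat.le_induction with
  | base =>
    intro _ hs
    have e := LR1 (a := a) h0 h1 hp 2 (by omega) (by omega) (fun i => s i + ev 2 i - ev 3 i)
      (fun i => s i - ev 2 i - ev 3 i) (fun i => s i + ev 1 i - ev 2 i - ev 0 i)
      (by simp [ev, hs 2]) (by intro i; ring)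
      (by intro i; rw [colv2]; ring)
    simp [e]
  | succ b hb ih =>
    intro hbp hs
    have e := LR1 (a := a) h0 h1 hp b (by omega) (by omega) (fun i => s i + ev b i - ev (b+1) i)
      (fun i => s i - ev b i - ev (b+1) i) (fun i => s i + ev (b-1) i - ev b i)
      (by simp [ev, hs b (by omega) (by omega)]) (by intro i; ring)
      (by intro i; simp only [ev, colv]; split_ifs <;> omega)
    rw [sum_Ico_succ_top (by omega), show b + 1 - 1 = b by omega, e,
      ih (by omega) (fun k h3 h4 => hs k h3 (by omega))]
    ring

lemma UDT (h0 : 0 < r) (h1 : r < 1) (hp : 4 ≤ p) (s : ℕ → ℤ) (b : ℕ) (hb : 3 ≤ b)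
    (hbp : b ≤ p - 1) (hs : ∀ k, 2 ≤ k → k < b → s k = 0) (hsb : s b = 1) :
    KK r p a (fun i => s i - ev 2 i + ev 3 i) + KK r p a (fun i => s i + ev 1 i - ev 2 i - ev 0 i)
    = KK r p a (fun i => s i + ev (b-1) i - ev b i) +
      (if b + 1 < p then r⁻¹ * KK r p a (fun i => s i - ev b i + ev (b+1) i) else 0) := by
  rw [tele_U h0 h1 hp s b hb hbp (fun k h3 h4 => hs k (by omega) h4),
    tele_D h0 h1 hp s b hb hbp hs]
  obtain ⟨c, rfl⟩ : ∃ c, b = c + 1 := ⟨b - 1, by omega⟩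
  rw [sum_Ico_succ_top (by omega), add_tsub_cancel_right]
  have top : KK r p a (fun i => s i - ev c i + ev (c+1) i) =
      KK r p a (fun i => s i - ev c i - ev (c+1) i) +
      (if c + 1 + 1 < p then r⁻¹ * KK r p a (fun i => s i - ev (c+1) i + ev (c+1+1) i) else 0) := by
    split_ifs with h
    · exact LR2 (a := a) h0 h1 hp (c+1) (by omega) h (fun i => s i - ev c i + ev (c+1) i)
        (fun i => s i - ev c i - ev (c+1) i) (fun i => s i - ev (c+1) i + ev (c+1+1) i)
        (by simp [ev, hsb]) (by intro i; ring)
        (by intro i; simp only [ev, colv]; split_ifs <;> omega)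
    · rw [add_zero]
      apply KK_par hp
      intro i
      rw [show p - 1 = c + 1 by omega]; ring
  rw [top]; ring

def vO (l : ℤ) (b : ℕ) : ℕ → ℤ := fun i => l * ev 0 i + ev 1 i + ev b i
def vE (l : ℤ) (b : ℕ) : ℕ → ℤ := fun i => l * ev 0 i + ev b i
def vZ (l : ℤ) : ℕ → ℤ := fun i => l * ev 0 i

lemma evn {k i : ℕ} (h : i ≠ k) : ev k i = 0 := by simp [ev, h]
lemma evs (k : ℕ) : ev k k = 1 := by simp [ev]

lemma R1 (h0 : 0 < r) (h1 : r < 1) (hp : 4 ≤ p) (ha : a ≤ p - 2) (b : ℕ) (hb : 3 ≤ b)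
    (hbp : b ≤ p - 1) (l : ℤ) (hl : 1 ≤ l) :
    KK r p a (vO l b) = KK r p a (vE (l-1) (b-1)) +
      (if b + 1 < p then r⁻¹ * KK r p a (vE (l-1) (b+1)) else 0) +
      r^(l-1) * KK r p a (vO (l-2) b) := by
  have g1 : KK r p a (vO l b) = KK r p a (fun i => l * ev 0 i - ev 1 i + ev b i) +
      KK r p a (fun i => l * ev 0 i - ev 1 i + ev 2 i + ev b i) := by
    apply LR1 h0 h1 hp 1 (by omega) (by omega)
    · simp [vO, ev]; omega
    · intro i; unfold vO; ring
    · intro i; simp only [vO, ev, colv]; split_ifs <;> omega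
  have g2 : KK r p a (fun i => l * ev 0 i - ev 1 i + ev 2 i + ev b i) =
      KK r p a (fun i => l * ev 0 i - ev 1 i - ev 2 i + ev b i) +
      KK r p a (fun i => ((l-1) * ev 0 i + ev b i) - ev 2 i + ev 3 i) := by
    apply LR1 h0 h1 hp 2 (by omega) (by omega)
    · simp [ev]; omega
    · intro i; ring
    · intro i; rw [colv2]; ring
  have g3 := UDT (a := a) h0 h1 hp (fun i => (l-1) * ev 0 i + ev b i) b hb hbp
    (by intro k h2 h3; simp [ev, show k ≠ 0 by omega, show k ≠ b by omega])
    (by simp [ev]; omega)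
  have g4 : KK r p a (fun i => ((l-1) * ev 0 i + ev b i) + ev 1 i - ev 2 i - ev 0 i) =
      KK r p a (fun i => (l-2) * ev 0 i - ev 1 i - ev 2 i + ev b i) +
      KK r p a (fun i => (l-2) * ev 0 i - ev 1 i + ev b i) := by
    apply LR1 h0 h1 hp 1 (by omega) (by omega)
    · simp [ev]; omega
    · intro i; ring
    · intro i; simp only [ev, colv]; split_ifs <;> omega
  have g5 : KK r p a (fun i => l * ev 0 i - ev 1 i + ev b i) =
      KK r p a (fun i => (l-2) * ev 0 i - ev 1 i + ev b i) + r^(l-1) *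
      KK r p a (fun i => (l-2) * ev 0 i - ev 1 i + ev 2 i + ev b i) := by
    apply N0Z h0 h1 hp ha _ _ _ b hbp
    · intro i hi; simp only [ev]; split_ifs <;> omega
    · intro i hi; simp only [ev]; split_ifs <;> omega
    · left; simp [ev]; omega
    · simp [ev]; omega
    · intro i; ring
    · intro i; ring
  have g6 : KK r p a (fun i => l * ev 0 i - ev 1 i - ev 2 i + ev b i) =
      KK r p a (fun i => (l-2) * ev 0 i - ev 1 i - ev 2 i + ev b i) + r^(l-1) *
      KK r p a (fun i => (l-2) * ev 0 i - ev 1 i + ev b i) := by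
    apply N0Z h0 h1 hp ha _ _ _ b hbp
    · intro i hi; simp only [ev]; split_ifs <;> omega
    · intro i hi; simp only [ev]; split_ifs <;> omega
    · left; simp [ev]; omega
    · simp [ev]; omega
    · intro i; ring
    · intro i; ring
  have g7 : KK r p a (vO (l-2) b) = KK r p a (fun i => (l-2) * ev 0 i - ev 1 i + ev b i) +
      KK r p a (fun i => (l-2) * ev 0 i - ev 1 i + ev 2 i + ev b i) := by
    apply LR1 h0 h1 hp 1 (by omega) (by omega)
    · simp [vO, ev]; omega
    · intro i; unfold vO; ring
    · intro i; simp only [vO, ev, colv]; split_ifs <;> omega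
  have g8 : KK r p a (fun i => ((l-1) * ev 0 i + ev b i) + ev (b-1) i - ev b i) =
      KK r p a (vE (l-1) (b-1)) := KK_congr (by intro i; unfold vE; ring)
  have g9 : KK r p a (fun i => ((l-1) * ev 0 i + ev b i) - ev b i + ev (b+1) i) =
      KK r p a (vE (l-1) (b+1)) := KK_congr (by intro i; unfold vE; ring)
  rw [g8, g9, g4] at g3
  rw [g1, g2, g7, g5, g6]
  linear_combination g3

lemma R1_2 (h0 : 0 < r) (h1 : r < 1) (hp : 4 ≤ p) (l : ℤ) :
    KK r p a (vO l 2) = KK r p a (vE l 1) + r⁻¹ * KK r p a (vE (l-1) 3) := by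
  have g1 : KK r p a (vO l 2) = KK r p a (fun i => l * ev 0 i - ev 1 i + ev 2 i) +
      KK r p a (fun i => l * ev 0 i - ev 1 i + 2 * ev 2 i) := by
    apply LR1 h0 h1 hp 1 (by omega) (by omega)
    · simp [vO, ev]
    · intro i; unfold vO; ring
    · intro i; simp only [vO, ev, colv]; split_ifs <;> omega
  have g2 : KK r p a (fun i => l * ev 0 i - ev 1 i + 2 * ev 2 i) =
      KK r p a (fun i => l * ev 0 i - ev 1 i) + r⁻¹ * KK r p a (vE (l-1) 3) := by
    apply LR2 h0 h1 hp 2 (by omega) (by omega)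
    · simp [ev]
    · intro i; ring
    · intro i; rw [colv2]; unfold vE; ring
  have g3 : KK r p a (vE l 1) = KK r p a (fun i => l * ev 0 i - ev 1 i) +
      KK r p a (fun i => l * ev 0 i - ev 1 i + ev 2 i) := by
    apply LR1 h0 h1 hp 1 (by omega) (by omega)
    · simp [vE, ev]
    · intro i; unfold vE; ring
    · intro i; simp only [vE, ev, colv]; split_ifs <;> omega
  rw [g1, g2, g3]; ring

def vT (l : ℤ) (b : ℕ) : ℕ → ℤ := fun i => l * ev 0 i + ev 2 i + ev b i

lemma R2 (h0 : 0 < r) (h1 : r < 1) (hp : 4 ≤ p) (ha : a ≤ p - 2) (b : ℕ) (hb : 3 ≤ b)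
    (hbp : b ≤ p - 1) (l : ℤ) (hl : 0 ≤ l) :
    KK r p a (vT l b) + r⁻¹ * KK r p a (vE (l-2) b) = KK r p a (vO (l-1) (b-1)) +
      (if b + 1 < p then r⁻¹ * KK r p a (vO (l-1) (b+1)) else 0) +
      r^(l-1) * KK r p a (vE (l-2) b) := by
  have g2 : KK r p a (vT l b) =
      KK r p a (fun i => l * ev 0 i - ev 2 i + ev b i) +
      KK r p a (fun i => ((l-1) * ev 0 i + ev 1 i + ev b i) - ev 2 i + ev 3 i) := by
    apply LR1 h0 h1 hp 2 (by omega) (by omega)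
    · simp [vT, ev]; omega
    · intro i; unfold vT; ring
    · intro i; rw [colv2]; unfold vT; ring
  have g3 := UDT (a := a) h0 h1 hp (fun i => (l-1) * ev 0 i + ev 1 i + ev b i) b hb hbp
    (by intro k h2 h3; simp [ev, show k ≠ 0 by omega, show k ≠ b by omega, show k ≠ 1 by omega])
    (by simp [ev]; omega)
  have g4 : KK r p a (fun i => ((l-1) * ev 0 i + ev 1 i + ev b i) + ev 1 i - ev 2 i - ev 0 i) =
      KK r p a (fun i => (l-2) * ev 0 i - ev 2 i + ev b i) + r⁻¹ * KK r p a (vE (l-2) b) := by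
    apply LR2 h0 h1 hp 1 (by omega) (by omega)
    · simp [ev]; omega
    · intro i; ring
    · intro i; simp only [vE, ev, colv]; split_ifs <;> omega
  have g5 : KK r p a (fun i => l * ev 0 i - ev 2 i + ev b i) =
      KK r p a (fun i => (l-2) * ev 0 i - ev 2 i + ev b i) + r^(l-1) *
      KK r p a (vE (l-2) b) := by
    apply N0Z h0 h1 hp ha _ _ _ b hbp
    · intro i hi; simp only [ev]; split_ifs <;> omega
    · intro i hi; simp only [ev]; split_ifs <;> omega
    · by_cases ha2 : a = 2
      · right
        refine ⟨b, by omega, ?_⟩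
        subst ha2
        have e : srcv 2 b = 0 := by unfold srcv; rw [if_neg (by omega)]
        simp [ev, e, show b ≠ 0 by omega, show b ≠ 2 by omega]
      · right
        refine ⟨2, by omega, ?_⟩
        have e : srcv a 2 = 0 := by unfold srcv; rw [if_neg (by omega)]
        simp [ev, e, show 2 ≠ b by omega]
    · simp [ev]; omega
    · intro i; ring
    · intro i; unfold vE; ring
  have g8 : KK r p a (fun i => ((l-1) * ev 0 i + ev 1 i + ev b i) + ev (b-1) i - ev b i) =
      KK r p a (vO (l-1) (b-1)) := KK_congr (by intro i; unfold vO; ring)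
  have g9 : KK r p a (fun i => ((l-1) * ev 0 i + ev 1 i + ev b i) - ev b i + ev (b+1) i) =
      KK r p a (vO (l-1) (b+1)) := KK_congr (by intro i; unfold vO; ring)
  rw [g8, g9, g4] at g3
  rw [g2, g5]
  linear_combination g3

lemma R2_2 (h0 : 0 < r) (h1 : r < 1) (hp : 4 ≤ p) (l : ℤ) :
    KK r p a (vT l 2) = KK r p a (vZ l) + r⁻¹ * KK r p a (vO (l-1) 3) := by
  apply LR2 h0 h1 hp 2 (by omega) (by omega)
  · simp [vT, ev]
  · intro i; unfold vT vZ; ring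
  · intro i; rw [colv2]; unfold vT vO; ring

/-- zero-node steps -/
lemma S_E (h0 : 0 < r) (h1 : r < 1) (hp : 4 ≤ p) (ha : a ≤ p - 2) (b : ℕ) (hb : 1 ≤ b)
    (hbp : b ≤ p - 1) (l : ℤ) (hl : 1 ≤ l) :
    KK r p a (vE l b) = KK r p a (vE (l-2) b) + r^(l-1) * KK r p a (vT (l-2) b) := by
  apply N0Z h0 h1 hp ha _ _ _ b hbp
  · intro i hi; simp only [vE, ev]; split_ifs <;> omega
  · intro i hi; simp only [vE, ev]; split_ifs <;> omega
  · left; simp [vE, ev]; omega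
  · simp [vE, ev]; omega
  · intro i; unfold vE; ring
  · intro i; unfold vE vT; ring

lemma S_Z (h0 : 0 < r) (h1 : r < 1) (hp : 4 ≤ p) (ha : a ≤ p - 2) (l : ℤ) (hl : 1 ≤ l) :
    KK r p a (vZ l) = KK r p a (vZ (l-2)) + r^(l-1) * KK r p a (vE (l-2) 2) := by
  apply N0Z h0 h1 hp ha _ _ _ 0 (by omega)
  · intro i hi; simp only [vZ, ev]; split_ifs <;> omega
  · intro i hi; simp only [vZ, ev]; split_ifs <;> omega
  · left; simp [vZ, ev]; omega
  · simp [vZ, ev]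
  · intro i; unfold vZ; ring
  · intro i; unfold vZ vE; ring

lemma vT_one (l : ℤ) : vT l 1 = vO l 2 := by funext i; unfold vT vO; ring

lemma KE_base (h0 : 0 < r) (h1 : r < 1) (hp : 4 ≤ p) (ha1 : 1 ≤ a) (ha : a ≤ p - 2) (b : ℕ)
    (hb : 2 ≤ b) (hbp : b ≤ p - 1) : KK r p a (vE 0 b) = if a = b then 1 else 0 := by
  rw [KK_base hp ha b hbp]
  · split_ifs with h
    · subst h
      apply wt_zero h0 h1
      intro i _
      unfold vE ev srcv
      by_cases hi : i = a
      · simp [hi, show 1 < a by omega]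
      · simp [hi]
    · apply wt_zero' hp _ b (by omega)
      unfold vE ev srcv
      simp [show b ≠ a by omega]
  · intro i hi; simp only [vE, ev]; split_ifs <;> omega
  · intro i hi; simp only [vE, ev]; split_ifs <;> omega
  · simp [vE, ev]; omega

lemma KZ_base (h0 : 0 < r) (h1 : r < 1) (hp : 4 ≤ p) (ha1 : 1 ≤ a) (ha : a ≤ p - 2) :
    KK r p a (vZ 0) = if a = 1 then 1 else 0 := by
  rw [KK_base hp ha 0 (by omega)]
  · split_ifs with h
    · subst h
      apply wt_zero h0 h1
      intro i _
      unfold vZ ev srcv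
      simp
    · apply wt_zero' hp _ a (by omega)
      unfold vZ ev srcv
      simp [show 1 < a by omega]
  · intro i hi; simp only [vZ, ev]; split_ifs <;> omega
  · intro i hi; simp only [vZ, ev]; split_ifs <;> omega
  · simp [vZ, ev]
end

section
variable {r : ℝ} {p a : ℕ}

/-- `a + δ_{a,1}` -/
def ap (a : ℕ) : ℕ := a + if a = 1 then 1 else 0

structure Claim (r : ℝ) (p a : ℕ) (L : ℤ) : Prop where
  cA : ∀ b : ℕ, 2 ≤ b → b ≤ p - 1 → b % 2 = ap a % 2 → KK r p a (vE (2*L) b) = bE r p a b L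
  cA1 : ap a % 2 = 1 → KK r p a (vE (2*L-1) 1) = bE r p a 1 L
  cB : ∀ b : ℕ, 2 ≤ b → b ≤ p - 1 → b % 2 ≠ ap a % 2 → KK r p a (vO (2*L-1) b) = bO r p a b L
  cB1 : ap a % 2 = 0 → KK r p a (vZ (2*L)) = bE r p a 0 L + (r^2)^L * bO r p a 1 L

lemma claim_neg (hp : 4 ≤ p) : Claim r p a (-1) := by
  constructor
  · intro b h1 h2 h3
    rw [bE_neg _ _ _ (by norm_num)]
    exact KK_neg hp (by simp [vE, ev]; omega)
  · intro h
    rw [bE_neg _ _ _ (by norm_num)]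
    exact KK_neg hp (by simp [vE, ev])
  · intro b h1 h2 h3
    rw [bO_neg _ _ _ (by norm_num)]
    exact KK_neg hp (by simp [vO, ev]; omega)
  · intro h
    rw [bE_neg _ _ _ (by norm_num), bO_neg _ _ _ (by norm_num)]
    rw [KK_neg hp (by simp [vZ, ev])]; simp

lemma claim_zero (h0 : 0 < r) (h1 : r < 1) (hp : 4 ≤ p) (ha1 : 1 ≤ a) (ha : a ≤ p - 2) :
    Claim r p a 0 := by
  constructor
  · intro b h2 h3 h4
    rw [bE_zero (by omega) (by omega) (by omega) (by omega), mul_zero, KE_base h0 h1 hp ha1 ha b h2 h3]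
    norm_cast
  · intro h
    rw [bE_zero (by omega) (by omega) (by omega) (by omega)]
    have : a ≠ 1 := by rintro rfl; simp [ap] at h
    rw [if_neg (by exact_mod_cast this)]
    exact KK_neg hp (by simp [vE, ev])
  · intro b h2 h3 h4
    rw [bO_zero (by omega) (by omega) (by omega) (by omega)]
    have : a ≠ b := by rintro rfl; apply h4; unfold ap; rw [if_neg (by omega)]; omega
    rw [if_neg (by exact_mod_cast this)]
    exact KK_neg hp (by simp [vO, ev]; omega)
  · intro h
    rw [bE_zero (by omega) (by omega) (by omega) (by omega),
      bO_zero (by omega) (by omega) (by omega) (by omega), mul_zero, KZ_base h0 h1 hp ha1 ha,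
      if_neg (show ¬ ((a:ℤ) = 0) by omega)]
    simp

lemma claim_step (h0 : 0 < r) (h1 : r < 1) (hp : 4 ≤ p) (ha1 : 1 ≤ a) (ha : a ≤ p - 2)
    (L : ℤ) (hL : 0 ≤ L) (c : Claim r p a L) (c' : Claim r p a (L-1)) : Claim r p a (L+1) := by
  have hp1 : (1:ℤ) ≤ p := by omega
  have hr : r ≠ 0 := h0.ne'
  have q1 : (r^2)^L = r^(2*L) := sq_zpow r L
  have q2 : (r^2)^(2*L) = r^(2*L) * r^(2*L) := by rw [sq_zpow, ← zpow_add₀ hr]; congr 1; ring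
  have q3 : r^(2*L+1) = r^(2*L) * r := by rw [zpow_add₀ hr, zpow_one]
  have q4 : r^(2*L-1) = r^(2*L) * r⁻¹ := by rw [zpow_sub₀ hr, zpow_one]; rfl
  have q5 : (r^2)^(L+1) = r^(2*L) * r^2 := by rw [zpow_add₀ (by positivity), q1]; simp
  have recE : ∀ b : ℤ, bE r p a b (L+1) = bE r p a b L + r^(2*L) * bO r p a (b+1) L
      + r^(2*L) * r * bO r p a (b-1) L
      + (r^(2*L) * r^(2*L) - r^(2*L)) * bE r p a b (L-1) := by
    intro b
    have := bE_rec (r := r) h0 h1 hp1 a b (L+1) (by omega)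
    rw [this, show L + 1 - 1 = L by ring, show 2 * (L+1) - 1 = 2*L+1 by ring,
      show 2*(L+1)-2 = 2*L by ring, show L+1-2 = L-1 by ring, q1, q2, q3]
  have recO : ∀ b : ℤ, bO r p a b (L+1) = r⁻¹ * bE r p a (b+1) L + bE r p a (b-1) L
      + r^(2*L) * bO r p a b L := by
    intro b
    have := bO_rec (r := r) h0 h1 hp1 a b (L+1) (by omega)
    rw [this, show L + 1 - 1 = L by ring, q1]
  have A1 : ap a % 2 = 1 → KK r p a (vE (2*(L+1)-1) 1) = bE r p a 1 L + r^(2*L) * bO r p a 2 L := by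
    intro h
    rw [S_E h0 h1 hp ha 1 le_rfl (by omega) _ (by omega), vT_one,
      show 2*(L+1)-1-2 = 2*L-1 by ring, show 2*(L+1)-1-1 = 2*L by ring, c.cA1 h,
      c.cB 2 le_rfl (by omega) (by omega)]
    rfl
  constructor
  · intro b hb2 hbp hba
    rw [S_E h0 h1 hp ha b (by omega) hbp _ (by omega), show 2*(L+1)-2 = 2*L by ring,
      show 2*(L+1)-1 = 2*L+1 by ring, c.cA b hb2 hbp hba, recE, q3]
    rcases Nat.lt_or_ge b 3 with hb | hb
    · have : b = 2 := by omega
      subst this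
      rw [R2_2 h0 h1 hp, c.cB1 (by omega), c.cB 3 (by omega) (by omega) (by omega)]
      have key : bE r p a 0 L = (1 - r^(2*L)) * (bO r p a 1 L - r⁻¹ * bE r p a 2 (L-1)) := by
        have w := bE_wall (r := r) h0 h1 hp1 a L
        rcases eq_or_ne L 0 with h | h
        · subst h; simpa using w
        · have o := bO_rec (r := r) h0 h1 hp1 a 1 L h
          norm_num at o
          rw [w, o, q1]; ring
      rw [key, q1]
      norm_num
      field_simp
      ring
    · have e := R2 (a := a) h0 h1 hp ha b hb hbp (2*L) (by omega)
      rw [show 2*L-2 = 2*(L-1) by ring, c'.cA b hb2 hbp hba,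
        c.cB (b-1) (by omega) (by omega) (by omega), q4] at e
      have e2 : (if b + 1 < p then r⁻¹ * KK r p a (vO (2*L-1) (b+1)) else 0)
          = r⁻¹ * bO r p a (b+1) L := by
        split_ifs with h
        · rw [c.cB (b+1) (by omega) (by omega) (by omega)]; push_cast; rfl
        · rw [show (b:ℤ) + 1 = p by omega, bO_p hp1, mul_zero]
      rw [e2] at e
      rw [show ((b-1 : ℕ):ℤ) = b - 1 by omega] at e
      have e3 : KK r p a (vT (2*L) b) = bO r p a (b-1) L + r⁻¹ * bO r p a (b+1) L
          + (r^(2*L) * r⁻¹ - r⁻¹) * bE r p a b (L-1) := by linear_combination e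
      rw [e3]
      field_simp
      ring
  · intro h
    rw [A1 h, recE]
    have w := bO_wall (r := r) h0 h1 hp1 a L
    norm_num
    rw [q1] at w
    linear_combination (-r^(2*L)) * w
  · intro b hb2 hbp hba
    rw [recO]
    rcases Nat.lt_or_ge b 3 with hb | hb
    · have : b = 2 := by omega
      subst this
      rw [R1_2 h0 h1 hp, A1 (by omega), show 2*(L+1)-1-1 = 2*L by ring,
        c.cA 3 (by omega) (by omega) (by omega)]
      norm_num
      ring
    · rw [R1 h0 h1 hp ha b hb hbp _ (by omega), show 2*(L+1)-1-1 = 2*L by ring,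
        show 2*(L+1)-1-2 = 2*L-1 by ring, c.cA (b-1) (by omega) (by omega) (by omega),
        c.cB b hb2 hbp hba, show ((b-1 : ℕ):ℤ) = b - 1 by omega]
      have e2 : (if b + 1 < p then r⁻¹ * KK r p a (vE (2*L) (b+1)) else 0)
          = r⁻¹ * bE r p a (b+1) L := by
        split_ifs with h
        · rw [c.cA (b+1) (by omega) (by omega) (by omega)]; push_cast; rfl
        · rw [show (b:ℤ) + 1 = p by omega, bE_p hp1, mul_zero]
      rw [e2]
      ring
  · intro h
    rw [S_Z h0 h1 hp ha _ (by omega), show 2*(L+1)-2 = 2*L by ring,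
      show 2*(L+1)-1 = 2*L+1 by ring, c.cB1 h, c.cA 2 le_rfl (by omega) (by omega), recO]
    have w := bE_wall (r := r) h0 h1 hp1 a (L+1)
    rw [show L + 1 - 1 = L by ring] at w
    rw [w, q5, q3, q1]
    norm_num
    field_simp
    ring

lemma claim_all (h0 : 0 < r) (h1 : r < 1) (hp : 4 ≤ p) (ha1 : 1 ≤ a) (ha : a ≤ p - 2) (n : ℕ) :
    Claim r p a n ∧ Claim r p a ((n:ℤ)-1) := by
  induction n with
  | zero => exact ⟨claim_zero h0 h1 hp ha1 ha, claim_neg hp⟩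
  | succ n ih =>
    push_cast
    refine ⟨claim_step h0 h1 hp ha1 ha n (by omega) ih.1 ih.2, ?_⟩
    simpa using ih.1
end

section
open Filter Topology
variable {q : ℝ}

lemma qPoch_anti (h0 : 0 < q) (h1 : q < 1) : Antitone (qPoch q) := by
  apply antitone_nat_of_succ_le
  intro n
  rw [qPoch_succ]
  have := qPoch_pos h0 h1 n
  have h2 : 0 < q^(n+1) := by positivity
  nlinarith

lemma qPoch_tendsto (h0 : 0 < q) (h1 : q < 1) :
    Tendsto (qPoch q) atTop (𝓝 (qPochInf q)) := by
  have hs : Summable (fun j : ℕ => -q^(j+1)) := by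
    apply Summable.neg
    exact (summable_nat_add_iff 1).2 (summable_geometric_of_lt_one h0.le h1)
  have hm := Real.multipliable_one_add_of_summable hs
  have e : qPoch q = fun n => ∏ j ∈ range n, (1 - q^(j+1)) := rfl
  rw [e]
  simpa [qPochInf, ← sub_eq_add_neg] using hm.tendsto_prod_tprod_nat

lemma qPochInf_pos (h0 : 0 < q) (h1 : q < 1) : 0 < qPochInf q := by
  have hs : Summable (fun j : ℕ => -q^(j+1)) := by
    apply Summable.neg
    exact (summable_nat_add_iff 1).2 (summable_geometric_of_lt_one h0.le h1)
  have hl := Real.summable_log_one_add_of_summable hs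
  have := Real.rexp_tsum_eq_tprod (f := fun j : ℕ => 1 + -q^(j+1))
    (fun i => by have := one_sub_pow_pos h0 h1 i; linarith) hl
  unfold qPochInf
  simp only [sub_eq_add_neg]
  rw [← this]
  exact Real.exp_pos _

lemma qPochInf_le (h0 : 0 < q) (h1 : q < 1) (n : ℕ) : qPochInf q ≤ qPoch q n :=
  (qPoch_anti h0 h1).le_of_tendsto (qPoch_tendsto h0 h1) n

def Minf (q : ℝ) (j k : ℤ) : ℝ :=
  if 0 ≤ j ∧ 0 ≤ k then 1 / (qPoch q j.toNat * qPoch q k.toNat) else 0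

lemma Minf_nonneg (h0 : 0 < q) (h1 : q < 1) (j k : ℤ) : 0 ≤ Minf q j k := by
  unfold Minf
  have := fun n => (qPoch_pos h0 h1 n)
  split_ifs
  · have := this j.toNat; have := qPoch_pos h0 h1 k.toNat; positivity
  · exact le_rfl

lemma Mt_nonneg (h0 : 0 < q) (h1 : q < 1) (N j k : ℤ) : 0 ≤ Mt q N j k := by
  unfold Mt
  have := fun n => (qPoch_pos h0 h1 n).le
  split_ifs
  · exact div_nonneg (this _) (mul_nonneg (mul_nonneg (this _) (this _)) (this _))
  · exact le_rfl

lemma Mt_le (h0 : 0 < q) (h1 : q < 1) (N j k : ℤ) : Mt q N j k ≤ Minf q j k := by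
  by_cases h : 0 ≤ j ∧ 0 ≤ k ∧ j + k ≤ N
  · unfold Mt Minf
    rw [if_pos h, if_pos ⟨h.1, h.2.1⟩]
    have p1 := qPoch_pos h0 h1 j.toNat
    have p2 := qPoch_pos h0 h1 k.toNat
    have p3 := qPoch_pos h0 h1 (N-j-k).toNat
    have p4 : qPoch q N.toNat ≤ qPoch q (N-j-k).toNat := qPoch_anti h0 h1 (by omega)
    rw [div_le_div_iff₀ (by positivity) (by positivity)]
    have : 0 < qPoch q j.toNat * qPoch q k.toNat := by positivity
    nlinarith
  · unfold Mt; rw [if_neg h]; exact Minf_nonneg h0 h1 j k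

lemma Minf_le (h0 : 0 < q) (h1 : q < 1) (j k : ℤ) : Minf q j k ≤ 1 / (qPochInf q * qPochInf q) := by
  have P := qPochInf_pos h0 h1
  unfold Minf
  split_ifs
  · apply one_div_le_one_div_of_le (by positivity)
    exact mul_le_mul (qPochInf_le h0 h1 _) (qPochInf_le h0 h1 _) P.le (qPoch_pos h0 h1 _).le
  · positivity

lemma Mt_tendsto (h0 : 0 < q) (h1 : q < 1) (j k : ℤ) :
    Tendsto (fun n : ℕ => Mt q n j k) atTop (𝓝 (Minf q j k)) := by
  have P := (qPochInf_pos h0 h1).ne'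
  by_cases h : 0 ≤ j ∧ 0 ≤ k
  · have e1 : Tendsto (fun n : ℕ => qPoch q ((n:ℤ)-j-k).toNat) atTop (𝓝 (qPochInf q)) := by
      apply (qPoch_tendsto h0 h1).comp
      apply tendsto_atTop_atTop.2
      intro b
      refine ⟨b + j.toNat + k.toNat, fun n hn => ?_⟩
      omega
    have p1 := (qPoch_pos h0 h1 j.toNat).ne'
    have p2 := (qPoch_pos h0 h1 k.toNat).ne'
    have e2 := (qPoch_tendsto h0 h1).div (e1.const_mul (qPoch q j.toNat * qPoch q k.toNat))
      (by simp [p1, p2, P])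
    have e3 : qPochInf q / (qPoch q j.toNat * qPoch q k.toNat * qPochInf q) = Minf q j k := by
      unfold Minf; rw [if_pos h]; field_simp
    rw [e3] at e2
    refine e2.congr' ?_
    filter_upwards [eventually_ge_atTop (j.toNat + k.toNat)] with n hn
    unfold Mt
    rw [if_pos (by omega)]
    simp
  · have e : ∀ n : ℕ, Mt q n j k = 0 := by intro n; unfold Mt; rw [if_neg (by tauto)]
    have e' : Minf q j k = 0 := by unfold Minf; rw [if_neg h]
    simp [e, e']

lemma summ_abs (h0 : 0 < q) (h1 : q < 1) : Summable (fun j : ℤ => q^|j|) := by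
  have := summable_geometric_of_lt_one h0.le h1
  apply Summable.of_nat_of_neg
  · simpa using this
  · simpa using this

lemma zpow_mono' (h0 : 0 < q) (h1 : q < 1) {m n : ℤ} (h : m ≤ n) : q^n ≤ q^m :=
  zpow_le_zpow_right_of_le_one₀ h0 h1.le h

lemma term_bound (h0 : 0 < q) (h1 : q < 1) (A j : ℤ) (C : ℝ) (hC : 0 ≤ C) (M : ℝ) (hM0 : 0 ≤ M)
    (hM : M ≤ Minf q j (j+A)) (hMC : M ≤ C) :
    q^(j*(j+A)) * M ≤ C * q^(-|A|) * q^|j| := by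
  by_cases h : 0 ≤ j ∧ 0 ≤ j + A
  · have : |j| + -|A| ≤ j*(j+A) := by
      rw [abs_of_nonneg h.1]
      rcases eq_or_lt_of_le h.2 with h2 | h2
      · rw [← h2]; have := neg_abs_le A; have := le_abs_self A; have := neg_le_abs A; omega
      · have := abs_nonneg A; nlinarith
    have e := zpow_mono' h0 h1 this
    rw [zpow_add₀ h0.ne'] at e
    calc q^(j*(j+A)) * M ≤ (q^|j| * q^(-|A|)) * C := by gcongr
      _ = _ := by ring
  · have : M = 0 := by
      apply le_antisymm _ hM0
      unfold Minf at hM; rwa [if_neg h] at hM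
    rw [this, mul_zero]; positivity

def t0 (q : ℝ) (A : ℤ) : ℝ := ∑' j : ℤ, q^(j*(j+A)) * Minf q j (j+A)

lemma t0_summ (h0 : 0 < q) (h1 : q < 1) (A : ℤ) :
    Summable (fun j : ℤ => q^(j*(j+A)) * Minf q j (j+A)) := by
  have P := qPochInf_pos h0 h1
  refine Summable.of_nonneg_of_le (fun j => mul_nonneg (zpow_nonneg h0.le _) (Minf_nonneg h0 h1 _ _))
    (fun j => term_bound h0 h1 A j (1 / (qPochInf q * qPochInf q)) (by positivity) _
      (Minf_nonneg h0 h1 _ _) le_rfl (Minf_le h0 h1 _ _)) ((summ_abs h0 h1).mul_left _)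

lemma TT_tendsto (h0 : 0 < q) (h1 : q < 1) (A : ℤ) :
    Tendsto (fun n : ℕ => TT q 0 n A) atTop (𝓝 (t0 q A)) := by
  unfold TT t0
  apply tendsto_tsum_of_dominated_convergence (t0_summ h0 h1 A)
  · intro j
    simp only [sub_zero]
    exact (Mt_tendsto h0 h1 _ _).const_mul _
  · refine Eventually.of_forall fun n j => ?_
    simp only [sub_zero]
    rw [Real.norm_of_nonneg (mul_nonneg (zpow_nonneg h0.le _) (Mt_nonneg h0 h1 _ _ _))]
    exact mul_le_mul_of_nonneg_left (Mt_le h0 h1 _ _ _) (zpow_nonneg h0.le _)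

lemma TT_nonneg (h0 : 0 < q) (h1 : q < 1) (L A : ℤ) : 0 ≤ TT q 0 L A :=
  tsum_nonneg fun _ => mul_nonneg (zpow_nonneg h0.le _) (Mt_nonneg h0 h1 _ _ _)

lemma TT_le (h0 : 0 < q) (h1 : q < 1) (L A : ℤ) : TT q 0 L A ≤ t0 q A := by
  refine hasSum_le (fun j => ?_) (TT_hasSum q 0 L A) (t0_summ h0 h1 A).hasSum
  simp only [sub_zero]
  exact mul_le_mul_of_nonneg_left (Mt_le h0 h1 _ _ _) (zpow_nonneg h0.le _)

lemma Minf_k (h0 : 0 < q) (h1 : q < 1) (j k : ℤ) : Minf q j k = (1 - q^(k+1)) * Minf q j (k+1) := by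
  unfold Minf
  by_cases h : 0 ≤ j ∧ 0 ≤ k
  · rw [if_pos h, if_pos (by omega), qPoch_toNat q (k+1) (by omega)]
    have e : k + 1 - 1 = k := by ring
    rw [e]
    have p1 := (qPoch_pos h0 h1 j.toNat).ne'
    have p2 := (qPoch_pos h0 h1 k.toNat).ne'
    have p3 := one_sub_zpow_ne h0 h1 (N := k+1) (by omega)
    field_simp
  · rw [if_neg h]
    by_cases h2 : 0 ≤ j ∧ 0 ≤ k + 1
    · have : k + 1 = 0 := by omega
      rw [this]; simp
    · rw [if_neg h2]; simp

lemma Minf_symm (j k : ℤ) : Minf q j k = Minf q k j := by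
  unfold Minf; rw [mul_comm]; simp only [and_comm]

lemma Minf_j (h0 : 0 < q) (h1 : q < 1) (j k : ℤ) : Minf q (j-1) k = (1 - q^j) * Minf q j k := by
  rw [Minf_symm, Minf_k h0 h1, Minf_symm]; simp

lemma t0_rec (h0 : 0 < q) (h1 : q < 1) (A : ℤ) :
    t0 q A = (1 - q^(A+1)) * t0 q (A+1) + q^(A+1) * t0 q (A+2) := by
  have b1 := (t0_summ h0 h1 (A+1)).hasSum.mul_left (1 - q^(A+1))
  have b2 := (hasSum_shift (t0_summ h0 h1 (A+2)).hasSum).mul_left (q^(A+1))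
  refine (t0_summ h0 h1 A).hasSum.unique (hs_congr (b1.add b2) ?_ rfl)
  intro j
  have e1 : Minf q j (j+A) = (1 - q^(j+A+1)) * Minf q j (j+A+1) := Minf_k h0 h1 _ _
  have e2 : Minf q (j-1) (j-1+(A+2)) = (1 - q^j) * Minf q j (j+A+1) := by
    rw [Minf_j h0 h1]; congr 2; ring
  rw [e1, e2, show j + (A+1) = j+A+1 by ring, show j*(j+A+1) = j*(j+A)+j by ring]
  have e3 : q^(A+1) * (q^((j-1)*(j-1+(A+2))) * ((1 - q^j) * Minf q j (j+A+1))) =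
      q^(j*(j+A)) * ((1 - q^j) * Minf q j (j+A+1)) := by
    rw [← mul_assoc, ← zpow_add₀ h0.ne']; congr 2; ring
  rw [e3, zpow_add₀ h0.ne' (j*(j+A)) j, show j+A+1 = j + (A+1) by ring, zpow_add₀ h0.ne' j (A+1)]
  ring

lemma t0_neg (A : ℤ) : t0 q (-A) = t0 q A := by
  unfold t0
  rw [← (Equiv.addRight A).tsum_eq]
  congr 1
  funext j
  simp only [Equiv.coe_addRight]
  rw [Minf_symm]
  congr 2 <;> ring

lemma t0_dom (h0 : 0 < q) (h1 : q < 1) (n : ℕ) (j : ℤ) :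
    q^(j*(j+(n:ℤ))) * Minf q j (j+(n:ℤ)) ≤ 1 / (qPochInf q * qPochInf q) * q^|j| := by
  have P := qPochInf_pos h0 h1
  by_cases h : 0 ≤ j
  · rw [mul_comm (1 / _), abs_of_nonneg h]
    have : j ≤ j * (j + n) := by
      rcases eq_or_lt_of_le h with h2 | h2
      · simp [← h2]
      · nlinarith
    have e := zpow_mono' h0 h1 this
    exact mul_le_mul e (Minf_le h0 h1 _ _) (Minf_nonneg h0 h1 _ _) (zpow_nonneg h0.le _)
  · unfold Minf; rw [if_neg (by tauto), mul_zero]; positivity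

lemma t0_nonneg (h0 : 0 < q) (h1 : q < 1) (A : ℤ) : 0 ≤ t0 q A :=
  tsum_nonneg fun _ => mul_nonneg (zpow_nonneg h0.le _) (Minf_nonneg h0 h1 _ _)

lemma t0_const (h0 : 0 < q) (h1 : q < 1) (n : ℕ) : t0 q n = t0 q (n+1) := by
  set B : ℝ := ∑' j : ℤ, 1 / (qPochInf q * qPochInf q) * q^|j|
  have hB : ∀ n : ℕ, t0 q n ≤ B := fun n =>
    hasSum_le (t0_dom h0 h1 n) (t0_summ h0 h1 n).hasSum ((summ_abs h0 h1).mul_left _).hasSum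
  have hd : ∀ n : ℕ, |t0 q n - t0 q (n+1)| ≤ B := by
    intro n
    have a1 := hB n
    have a2 := hB (n+1)
    have a3 := t0_nonneg h0 h1 n
    have a4 := t0_nonneg h0 h1 (n+1)
    push_cast at a2
    rw [abs_le]; constructor <;> linarith
  have hB0 : 0 ≤ B := (abs_nonneg _).trans (hd 0)
  have step : ∀ n : ℕ, |t0 q n - t0 q (n+1)| ≤ q * |t0 q ((n+1 : ℕ)) - t0 q ((n+1 : ℕ)+1)| := by
    intro n
    have := t0_rec h0 h1 n
    have e : t0 q n - t0 q (n+1) = - (q^((n:ℤ)+1) * (t0 q ((n+1 : ℕ)) - t0 q ((n+1 : ℕ)+1))) := by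
      rw [this]; push_cast; rw [show (n:ℤ)+1+1 = n+2 by ring]; ring
    rw [e, abs_neg, abs_mul, abs_of_pos (zpow_pos h0 _)]
    apply mul_le_mul_of_nonneg_right _ (abs_nonneg _)
    have := zpow_mono' h0 h1 (show (1:ℤ) ≤ n + 1 by omega)
    simpa using this
  have all : ∀ k n : ℕ, |t0 q n - t0 q (n+1)| ≤ q^k * B := by
    intro k
    induction k with
    | zero => intro n; simpa using hd n
    | succ k ih =>
      intro n
      calc _ ≤ _ := step n
        _ ≤ q * (q^k * B) := mul_le_mul_of_nonneg_left (ih (n+1)) h0.le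
        _ = _ := by ring
  have lim : Tendsto (fun k : ℕ => q^k * B) atTop (𝓝 (0 * B)) :=
    (tendsto_pow_atTop_nhds_zero_of_lt_one h0.le h1).mul_const B
  rw [zero_mul] at lim
  have := ge_of_tendsto' lim (fun k => all k n)
  have := abs_nonpos_iff.1 this
  linarith

lemma t0_lim (h0 : 0 < q) (h1 : q < 1) :
    Tendsto (fun n : ℕ => t0 q n) atTop (𝓝 (1 / qPochInf q)) := by
  have P := qPochInf_pos h0 h1
  have key : Tendsto (fun n : ℕ => t0 q n) atTop
      (𝓝 (∑' j : ℤ, if j = 0 then 1 / qPochInf q else 0)) := by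
    unfold t0
    apply tendsto_tsum_of_dominated_convergence
      ((summ_abs h0 h1).mul_left (1 / (qPochInf q * qPochInf q)))
    · intro j
      rcases lt_trichotomy j 0 with h | h | h
      · have : ∀ n : ℕ, Minf q j (j+n) = 0 := by intro n; unfold Minf; rw [if_neg (by omega)]
        simp [this, h.ne]
      · subst h
        have : ∀ n : ℕ, q^((0:ℤ)*(0+n)) * Minf q 0 (0+n) = 1 / qPoch q n := by
          intro n; unfold Minf; simp [qPoch_zero]
        simp only [this, if_true]
        exact tendsto_const_nhds.div (qPoch_tendsto h0 h1) P.ne'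
      · rw [if_neg h.ne']
        have lim : Tendsto (fun k : ℕ => q^k * (1 / (qPochInf q * qPochInf q))) atTop
            (𝓝 (0 * (1 / (qPochInf q * qPochInf q)))) :=
          (tendsto_pow_atTop_nhds_zero_of_lt_one h0.le h1).mul_const _
        rw [zero_mul] at lim
        refine squeeze_zero (fun n => mul_nonneg (zpow_nonneg h0.le _) (Minf_nonneg h0 h1 _ _))
          (fun n => ?_) lim
        apply mul_le_mul _ (Minf_le h0 h1 _ _) (Minf_nonneg h0 h1 _ _) (by positivity)
        rw [← zpow_natCast]
        apply zpow_mono' h0 h1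
        nlinarith
    · refine Eventually.of_forall fun n j => ?_
      rw [Real.norm_of_nonneg (mul_nonneg (zpow_nonneg h0.le _) (Minf_nonneg h0 h1 _ _))]
      exact t0_dom h0 h1 n j
  rwa [tsum_ite_eq] at key

lemma t0_eq (h0 : 0 < q) (h1 : q < 1) (A : ℤ) : t0 q A = 1 / qPochInf q := by
  have c : ∀ n : ℕ, t0 q n = t0 q 0 := by
    intro n
    induction n with
    | zero => simp
    | succ n ih => rw [← ih, t0_const h0 h1 n]; push_cast; rfl
  have z : t0 q 0 = 1 / qPochInf q := by
    have := t0_lim h0 h1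
    simp only [c] at this
    exact tendsto_nhds_unique tendsto_const_nhds this
  rcases le_total 0 A with h | h
  · rw [show A = (A.toNat : ℤ) by omega, c, z]
  · rw [← t0_neg, show -A = ((-A).toNat : ℤ) by omega, c, z]
end

section
open Filter Topology
variable {q : ℝ}

lemma quad_summ (h0 : 0 < q) (h1 : q < 1) (N c d : ℤ) (hN : 1 ≤ N) :
    Summable (fun j : ℤ => q^(N * j^2 + c * j + d)) := by
  refine Summable.of_nonneg_of_le (fun j => zpow_nonneg h0.le _) (fun j => ?_)
    ((summ_abs h0 h1).mul_left (q^(d - (|c|+1)^2)))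
  rw [← zpow_add₀ h0.ne']
  apply zpow_mono' h0 h1
  have e1 : -(|c| * |j|) ≤ c * j := by rw [← abs_mul]; exact neg_abs_le _
  have e2 : |j|^2 ≤ N * j^2 := by rw [sq_abs]; nlinarith [sq_nonneg j]
  have e3 := abs_nonneg c
  have e4 := abs_nonneg j
  nlinarith [sq_nonneg (|c| + 1 - |j|)]

lemma exE_summ (h0 : 0 < q) (h1 : q < 1) (p a b : ℤ) (hp : 1 ≤ p) :
    Summable (fun j : ℤ => q^(exE p a b j)) := by
  have := quad_summ h0 h1 (p*(p+1)) ((p+1)*a - p*(b+1)) 0 (by nlinarith)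
  refine this.congr fun j => ?_
  unfold exE; congr 1; ring

lemma exE'_summ (h0 : 0 < q) (h1 : q < 1) (p a b : ℤ) (hp : 1 ≤ p) :
    Summable (fun j : ℤ => q^(exE' p a b j)) := by
  have := quad_summ h0 h1 (p*(p+1)) ((p+1)*a + p*(b+1)) (a*(b+1)) (by nlinarith)
  refine this.congr fun j => ?_
  unfold exE'; congr 1; ring

lemma bE_lim {r : ℝ} (h0 : 0 < r) (h1 : r < 1) (p a b : ℤ) (hp : 1 ≤ p) :
    Tendsto (fun n : ℕ => bE r p a b n) atTop (𝓝 (r^(tri (b-a)) * chiV p a (b+1) (r^2))) := by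
  have hq0 : 0 < r^2 := by positivity
  have hq1 : r^2 < 1 := by nlinarith
  have P := qPochInf_pos hq0 hq1
  have s1 := exE_summ hq0 hq1 p a b hp
  have s2 := exE'_summ hq0 hq1 p a b hp
  have lim : ∀ A, Tendsto (fun n : ℕ => TT (r^2) 0 n A) atTop (𝓝 (1 / qPochInf (r^2))) := by
    intro A; rw [← t0_eq hq0 hq1 A]; exact TT_tendsto hq0 hq1 A
  have key : r^(tri (b-a)) * chiV p a (b+1) (r^2) = ∑' j : ℤ,
      (r^(tri (b-a)) * (r^2)^(exE p a b j) * (1 / qPochInf (r^2))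
       - r^(tri (b-a)) * (r^2)^(exE' p a b j) * (1 / qPochInf (r^2))) := by
    unfold chiV
    rw [← tsum_div_const, ← tsum_mul_left]
    congr 1
    funext j
    unfold exE exE'
    ring
  rw [key]
  unfold bE
  apply tendsto_tsum_of_dominated_convergence
    (((s1.mul_left (r^(tri (b-a)))).mul_right (1 / qPochInf (r^2))).add
     ((s2.mul_left (r^(tri (b-a)))).mul_right (1 / qPochInf (r^2))))
  · intro j
    exact ((lim _).const_mul _).sub ((lim _).const_mul _)
  · refine Eventually.of_forall fun n j => ?_
    refine (norm_sub_le _ _).trans ?_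
    unfold bEp bEm
    have t : ∀ A, TT (r^2) 0 n A ≤ 1 / qPochInf (r^2) := by
      intro A; rw [← t0_eq hq0 hq1 A]; exact TT_le hq0 hq1 _ A
    have t2 := fun A => TT_nonneg hq0 hq1 n A
    rw [Real.norm_of_nonneg (mul_nonneg (by positivity) (t2 _)),
      Real.norm_of_nonneg (mul_nonneg (by positivity) (t2 _))]
    exact add_le_add (mul_le_mul_of_nonneg_left (t _) (by positivity))
      (mul_le_mul_of_nonneg_left (t _) (by positivity))
end

section
open Filter Topology
variable {r : ℝ} {p a : ℕ}

def Rp (r : ℝ) (p a b : ℕ) (m : ℕ → ℕ) : ℝ :=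
  ∏ i ∈ Ico 1 p, fac r p i (topv a (vE 0 b) m i) (m i)

open Classical in
def winf (r : ℝ) (p a b : ℕ) (m : ℕ → ℕ) : ℝ :=
  if ∀ k, p ≤ k → m k = 0 then
    r ^ (Qf p (vE 0 b) m) * (1 / qPoch (r^2) (m 0)) * Rp r p a b m else 0

lemma wt_form (hp : 4 ≤ p) (b : ℕ) (hb : 1 ≤ b) (l : ℤ) (m : ℕ → ℕ)
    (hm : ∀ k, p ≤ k → m k = 0) :
    wt r p a (vE l b) m =
      r ^ (Qf p (vE 0 b) m) * bn r (l - m 2) (m 0) * Rp r p a b m := by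
  unfold wt
  rw [if_pos hm, prod_range_eq_mul_Ico _ (by omega)]
  have e1 : Qf p (vE l b) m = Qf p (vE 0 b) m := by
    unfold Qf
    refine sum_congr rfl fun i _ => ?_
    by_cases h : i = 0
    · simp [h]
    · simp [vE, ev, h]
  have e2 : fac r p 0 (topv a (vE l b) m 0) (m 0) = bn r (l - m 2) (m 0) := by
    unfold fac
    rw [if_neg (by omega)]
    congr 1
    unfold topv nb vE ev srcv
    rw [if_neg (show ¬ 0 = b by omega), if_neg (show ¬ (1 < a ∧ 0 = a) by omega)]
    simp; ring
  have e3 : ∏ i ∈ Ico 1 p, fac r p i (topv a (vE l b) m i) (m i) = Rp r p a b m := by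
    unfold Rp
    refine prod_congr rfl fun i hi => ?_
    have : i ≠ 0 := by have := (mem_Ico.1 hi).1; omega
    congr 1
    unfold topv vE ev
    simp [this]
  rw [e1, e2, e3, mul_assoc]

lemma Rp_nonneg (h0 : 0 < r) (h1 : r < 1) (b : ℕ) (m : ℕ → ℕ) : 0 ≤ Rp r p a b m :=
  prod_nonneg fun _ _ => fac_nonneg h0 h1 _ _ _

lemma Rp_par (hp : 4 ≤ p) (b : ℕ) (m : ℕ → ℕ) (h : Rp r p a b m ≠ 0) :
    Even ((m 2 : ℤ) + ev b 1) := by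
  by_contra hc
  apply h
  apply prod_eq_zero (i := 1) (mem_Ico.2 (by omega))
  unfold fac
  rw [if_neg (by omega)]
  unfold bn
  rw [if_neg]
  rintro ⟨h1, -⟩
  apply hc
  have : srcv a 1 = 0 := by unfold srcv; rw [if_neg (by omega)]
  unfold topv nb vE at h1
  rw [this] at h1
  simpa [ev] using h1

lemma bn_le (h0 : 0 < r) (h1 : r < 1) (t : ℤ) (m : ℕ) : bn r t m ≤ 1 / qPoch (r^2) m := by
  have hq0 : 0 < r^2 := by positivity
  have hq1 : r^2 < 1 := by nlinarith
  have p1 := qPoch_pos hq0 hq1 m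
  unfold bn
  split_ifs
  · have p3 := qPoch_pos hq0 hq1 ((t/2).toNat - m)
    have p4 : qPoch (r^2) (t/2).toNat ≤ qPoch (r^2) ((t/2).toNat - m) :=
      qPoch_anti hq0 hq1 (by omega)
    rw [div_le_div_iff₀ (by positivity) (by positivity)]
    nlinarith
  · positivity

lemma bn_tendsto (h0 : 0 < r) (h1 : r < 1) (c : ℤ) (hc : Even c) (m : ℕ) :
    Tendsto (fun n : ℕ => bn r (2 * (n:ℤ) - c) m) atTop (𝓝 (1 / qPoch (r^2) m)) := by
  have hq0 : 0 < r^2 := by positivity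
  have hq1 : r^2 < 1 := by nlinarith
  have P := (qPochInf_pos hq0 hq1).ne'
  have p1 := (qPoch_pos hq0 hq1 m).ne'
  have hc' : ¬ ¬ Even c := not_not.2 hc
  have e0 : Tendsto (fun n : ℕ => qPoch (r^2) ((2 * (n:ℤ) - c)/2).toNat) atTop
      (𝓝 (qPochInf (r^2))) := by
    apply (qPoch_tendsto hq0 hq1).comp
    apply tendsto_atTop_atTop.2
    intro b
    refine ⟨b + c.natAbs + 1, fun n hn => ?_⟩
    omega
  have e1 : Tendsto (fun n : ℕ => qPoch (r^2) (((2 * (n:ℤ) - c)/2).toNat - m)) atTop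
      (𝓝 (qPochInf (r^2))) := by
    apply (qPoch_tendsto hq0 hq1).comp
    apply tendsto_atTop_atTop.2
    intro b
    refine ⟨b + c.natAbs + m + 1, fun n hn => ?_⟩
    omega
  have e2 := e0.div (e1.const_mul (qPoch (r^2) m)) (by simp [p1, P])
  have e3 : qPochInf (r^2) / (qPoch (r^2) m * qPochInf (r^2)) = 1 / qPoch (r^2) m := by
    field_simp
  rw [e3] at e2
  refine e2.congr' ?_
  filter_upwards [eventually_ge_atTop (c.natAbs + m + 1)] with n hn
  unfold bn
  rw [if_pos]
  · rfl
  · refine ⟨?_, by omega⟩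
    exact (even_two_mul _).sub hc

lemma winf_nonneg (h0 : 0 < r) (h1 : r < 1) (b : ℕ) (m : ℕ → ℕ) : 0 ≤ winf r p a b m := by
  have hq0 : 0 < r^2 := by positivity
  have hq1 : r^2 < 1 := by nlinarith
  unfold winf
  split_ifs
  · have := qPoch_pos hq0 hq1 (m 0)
    exact mul_nonneg (by positivity) (Rp_nonneg h0 h1 _ _)
  · exact le_rfl

lemma wt_le_winf (h0 : 0 < r) (h1 : r < 1) (hp : 4 ≤ p) (b : ℕ) (hb : 1 ≤ b) (l : ℤ)
    (m : ℕ → ℕ) : wt r p a (vE l b) m ≤ winf r p a b m := by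
  by_cases hm : ∀ k, p ≤ k → m k = 0
  · rw [wt_form hp b hb l m hm]
    unfold winf
    rw [if_pos hm]
    apply mul_le_mul_of_nonneg_right _ (Rp_nonneg h0 h1 _ _)
    exact mul_le_mul_of_nonneg_left (bn_le h0 h1 _ _) (zpow_nonneg h0.le _)
  · unfold wt winf; rw [if_neg hm, if_neg hm]

lemma wt_tendsto (h0 : 0 < r) (h1 : r < 1) (hp : 4 ≤ p) (b : ℕ) (hb : 1 ≤ b) (m : ℕ → ℕ) :
    Tendsto (fun n : ℕ => wt r p a (vE (2 * (n:ℤ) - ev b 1) b) m) atTop (𝓝 (winf r p a b m)) := by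
  by_cases hm : ∀ k, p ≤ k → m k = 0
  · simp only [wt_form hp b hb _ m hm]
    unfold winf
    rw [if_pos hm]
    by_cases hR : Rp r p a b m = 0
    · simp [hR]
    · have par := Rp_par hp b m hR
      apply Tendsto.mul_const
      apply Tendsto.const_mul
      have := bn_tendsto h0 h1 _ par (m 0)
      refine this.congr fun n => ?_
      congr 1; ring
  · unfold wt winf; rw [if_neg hm]; simp [hm]

lemma winf_hasSum (h0 : 0 < r) (h1 : r < 1) (hp : 4 ≤ p) (b : ℕ) (hb : 1 ≤ b) (S : ℝ)
    (hl : Tendsto (fun n : ℕ => KK r p a (vE (2 * (n:ℤ) - ev b 1) b)) atTop (𝓝 S)) :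
    HasSum (winf r p a b) S := by
  have hs : Summable (winf r p a b) := by
    apply summable_of_sum_le (c := S) (fun m => winf_nonneg h0 h1 b m)
    intro u
    have t := tendsto_finsetSum u (fun m _ => wt_tendsto (a := a) h0 h1 hp b hb m)
    refine le_of_tendsto_of_tendsto' t hl fun n => ?_
    exact (wt_summ hp _).sum_le_tsum u (fun m _ => wt_nonneg h0 h1 _ m)
  have t2 := tendsto_tsum_of_dominated_convergence (𝓕 := atTop)
    (f := fun (n : ℕ) m => wt r p a (vE (2 * (n:ℤ) - ev b 1) b) m) hs
    (fun m => wt_tendsto (a := a) h0 h1 hp b hb m)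
    (Eventually.of_forall fun n m => by
      rw [Real.norm_of_nonneg (wt_nonneg h0 h1 _ m)]; exact wt_le_winf h0 h1 hp b hb _ m)
  have := tendsto_nhds_unique hl t2
  rw [this]
  exact hs.hasSum

lemma main_sum (h0 : 0 < r) (h1 : r < 1) (hp : 4 ≤ p) (ha1 : 1 ≤ a) (ha : a ≤ p - 2) (b : ℕ)
    (hb : 1 ≤ b) (hb2 : b ≤ p - 1) (hpar : b % 2 = ap a % 2) :
    HasSum (winf r p a b) (r^(tri (b-a)) * chiV p a (b+1) (r^2)) := by
  apply winf_hasSum h0 h1 hp b hb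
  refine (bE_lim h0 h1 p a b (by omega)).congr fun n => ?_
  have c := (claim_all h0 h1 hp ha1 ha n).1
  rcases Nat.lt_or_ge b 2 with h | h
  · have : b = 1 := by omega
    subst this
    rw [evs, c.cA1 (by omega)]; rfl
  · rw [evn (show 1 ≠ b by omega), sub_zero, c.cA b h hb2 hpar]
end

section
variable {r : ℝ} {p a : ℕ}

def extm (p : ℕ) (m : Fin (p-1) → ℕ) : ℕ → ℕ := fun k => if h : k < p - 1 then m ⟨k, h⟩ else 0

lemma extm_ge (m : Fin (p-1) → ℕ) (k : ℕ) (h : p - 1 ≤ k) : extm p m k = 0 := by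
  unfold extm; rw [dif_neg (by omega)]

lemma extm_fin (m : Fin (p-1) → ℕ) (i : Fin (p-1)) : extm p m i.val = m i := by
  unfold extm; rw [dif_pos i.2]

lemma extm_inj : Function.Injective (extm p) := by
  intro m m' h
  funext i
  rw [← extm_fin m i, ← extm_fin m' i, h]

/-- integer-indexed version of the matrix -/
def itn (i j : ℕ) : ℚ :=
  if i = 0 then (if j = 2 then -1 else 0)
  else if j = 0 then (if i = 2 then 1 else 0)
  else if i = j + 1 ∨ j = i + 1 then 1 else 0

lemma ind_sum (n c : ℕ) (M : ℕ → ℕ) (hM : ∀ k, n ≤ k → M k = 0) :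
    ∑ j ∈ range n, (if j = c then (1:ℚ) else 0) * (M j : ℚ) = M c := by
  simp only [ite_mul, one_mul, zero_mul]
  rw [sum_ite_eq']
  split_ifs with h
  · rfl
  · rw [hM c (by simpa using h)]; simp

lemma row_nat (n : ℕ) (M : ℕ → ℕ) (hM : ∀ k, n ≤ k → M k = 0) (i : ℕ) :
    ∑ j ∈ range n, itn i j * (M j : ℚ) = (nb M i : ℚ) := by
  have I := fun c => ind_sum n c M hM
  unfold nb
  by_cases h0 : i = 0
  · subst h0
    rw [if_pos rfl]; push_cast; rw [← I 2, ← sum_neg_distrib]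
    refine sum_congr rfl fun j _ => ?_
    unfold itn; rw [if_pos rfl]; split_ifs <;> simp
  by_cases h1 : i = 1
  · subst h1
    rw [if_neg h0, if_pos rfl]; push_cast; rw [← I 2]
    refine sum_congr rfl fun j _ => ?_
    unfold itn
    congr 1
    rw [if_neg h0]
    by_cases hj : j = 2
    · simp [hj]
    · rw [if_neg hj]; split_ifs <;> first | rfl | omega
  by_cases h2 : i = 2
  · subst h2
    rw [if_neg h0, if_neg h1, if_pos rfl]; push_cast; rw [← I 1, ← I 3, ← I 0, ← sum_add_distrib,
      ← sum_add_distrib]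
    refine sum_congr rfl fun j _ => ?_
    rw [← add_mul, ← add_mul]
    unfold itn
    congr 1
    rcases Nat.lt_or_ge j 4 with hj | hj
    · interval_cases j <;> norm_num
    · rw [if_neg h0, if_neg (by omega), if_neg (by omega), if_neg (by omega), if_neg (by omega),
        if_neg (by omega)]; norm_num
  · rw [if_neg h0, if_neg h1, if_neg h2]; push_cast; rw [← I (i-1), ← I (i+1), ← sum_add_distrib]
    refine sum_congr rfl fun j _ => ?_
    rw [← add_mul]
    unfold itn
    congr 1
    rw [if_neg h0]
    by_cases e1 : j = i - 1
    · rw [if_neg (by omega), if_pos (by omega), if_pos e1, if_neg (by omega)]; norm_num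
    by_cases e2 : j = i + 1
    · rw [if_neg (by omega), if_pos (by omega), if_neg e1, if_pos e2]; norm_num
    rw [if_neg e1, if_neg e2]
    split_ifs <;> first | omega | norm_num

lemma row_fin (m : Fin (p-1) → ℕ) (i : Fin (p-1)) :
    ∑ j, ItM p i j * (m j : ℚ) = (nb (extm p m) i.val : ℚ) := by
  rw [← row_nat (p-1) (extm p m) (extm_ge m) i.val,
    ← Fin.sum_univ_eq_sum_range (fun j => itn i.val j * (extm p m j : ℚ))]
  refine sum_congr rfl fun j _ => ?_
  rw [extm_fin]
  rfl

lemma quad_nat (M : ℕ → ℕ) (n : ℕ) :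
    ∑ i ∈ range (n+3), (M i : ℤ) * nb M i =
      2 * ∑ i ∈ range (n+3), (if i = 0 then 0 else (M i : ℤ) * M (i+1)) - M (n+2) * M (n+3) := by
  induction n with
  | zero => simp [sum_range_succ, nb]; ring
  | succ n ih =>
    rw [show n + 1 + 3 = (n+3) + 1 by ring, sum_range_succ, ih, sum_range_succ _ (n+3)]
    have : nb M (n+3) = M (n+2) + M (n+4) := by
      unfold nb; rw [if_neg (by omega), if_neg (by omega), if_neg (by omega)]; rfl
    rw [this, if_neg (by omega)]
    rw [show n + 1 + 2 = n + 3 by ring, show n + 3 + 1 = n + 4 by ring]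
    ring

lemma Phi_eq (hp : 4 ≤ p) (b : ℕ) (A : Fin (p-1) → ℚ) (hb : 1 ≤ b)
    (hA : ∀ i : Fin (p-1), A i = (ev b i.val : ℚ)) (m : Fin (p-1) → ℕ) :
    PhiQ p A m = (Qf p (vE 0 b) (extm p m) : ℚ) / 2 := by
  set M := extm p m with hM
  have z : ∀ k, p - 1 ≤ k → M k = 0 := extm_ge m
  have e1 : ∀ i : Fin (p-1), ∑ j, (m i : ℚ) * CtM p i j * (m j : ℚ)
      = 2 * (M i.val : ℚ)^2 - (M i.val : ℚ) * (nb M i.val : ℚ) := by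
    intro i
    rw [hM, ← row_fin m i, extm_fin]
    unfold CtM
    have : ∀ j, (m i : ℚ) * ((if i = j then 2 else 0) - ItM p i j) * (m j : ℚ)
      = (if i = j then 2 * (m i : ℚ) * (m j : ℚ) else 0) - (m i : ℚ) * (ItM p i j * (m j : ℚ)) := by
      intro j; split_ifs <;> ring
    simp only [this]
    rw [sum_sub_distrib, ← mul_sum, sum_ite_eq]
    simp; ring
  have e2 : ∑ j, A j * (m j : ℚ) = ∑ i ∈ range (p-1), (ev b i : ℚ) * (M i : ℚ) := by
    rw [← Fin.sum_univ_eq_sum_range (fun i => (ev b i : ℚ) * (M i : ℚ))]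
    refine sum_congr rfl fun i _ => ?_
    rw [hA, hM, extm_fin]
  unfold PhiQ
  rw [sum_congr rfl (fun i _ => e1 i), e2,
    Fin.sum_univ_eq_sum_range (fun i => 2 * (M i : ℚ)^2 - (M i : ℚ) * (nb M i : ℚ))]
  have hext : ∀ f : ℕ → ℚ, f (p-1) = 0 → ∑ i ∈ range (p-1), f i = ∑ i ∈ range p, f i := by
    intro f hf
    have h := sum_range_succ f (p-1)
    rw [show p - 1 + 1 = p by omega] at h
    rw [h, hf, add_zero]
  rw [hext _ (by simp [z (p-1) le_rfl]), hext _ (by simp [z (p-1) le_rfl])]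
  have qn := quad_nat M (p - 3)
  rw [show p - 3 + 3 = p by omega, z p (by omega)] at qn
  have qn' : ∑ i ∈ range p, (M i : ℚ) * (nb M i : ℚ) =
      2 * ∑ i ∈ range p, (if i = 0 then 0 else (M i : ℚ) * M (i+1)) := by
    have := congrArg (fun x : ℤ => (x : ℚ)) qn
    push_cast at this
    simpa using this
  have qf : (Qf p (vE 0 b) M : ℚ) = ∑ i ∈ range p, (M i : ℚ)^2
      - ∑ i ∈ range p, (ev b i : ℚ) * (M i : ℚ)
      - ∑ i ∈ range p, (if i = 0 then 0 else (M i : ℚ) * M (i+1)) := by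
    unfold Qf
    push_cast
    rw [← sum_sub_distrib, ← sum_sub_distrib]
    refine sum_congr rfl fun i _ => ?_
    by_cases hi : i = 0
    · subst hi; simp [evn (show 0 ≠ b by omega)]
    · simp only [if_neg hi, vE]; push_cast; ring
  rw [qf, sum_sub_distrib, qn', ← mul_sum]
  ring

lemma qBin_eq (t : ℤ) (N : ℚ) (hN : N = (t:ℚ)/2) (m : ℕ) : qBinQ (r^2) N m = bn r t m := by
  unfold qBinQ bn
  by_cases he : Even t
  · obtain ⟨k, hk⟩ := he
    have : N = (k : ℚ) := by rw [hN, hk]; push_cast; ring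
    rw [this]
    have e : t / 2 = k := by omega
    rw [e]
    simp only [Rat.den_intCast, Rat.num_intCast, true_and]
    have c1 : ((m:ℚ) ≤ (k:ℚ)) ↔ (Even t ∧ 2 * (m:ℤ) ≤ t) := by
      have : ((m:ℚ) ≤ (k:ℚ)) ↔ (m:ℤ) ≤ k := by exact_mod_cast Iff.rfl
      rw [this]
      constructor
      · intro h; exact ⟨⟨k, hk⟩, by omega⟩
      · intro h; omega
    simp only [c1]
  · rw [if_neg, if_neg (by tauto)]
    rintro ⟨h, -⟩
    apply he
    have e : (N.num : ℚ) = N := Rat.coe_int_num_of_den_eq_one h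
    have : (t:ℚ) = (N.num + N.num : ℤ) := by push_cast; rw [e, hN]; ring
    exact ⟨N.num, by exact_mod_cast this⟩

lemma ptil_eq (b : ℕ) (hb : 1 ≤ b) (h : (b + a + kdel a 1) % 2 = 0) :
    ptil (a + kdel a 1 + b + kdel b 1 + (if (0:ℕ) = 1 then p - 1 else 0)) = if b = 1 then 1 else 0 := by
  unfold ptil
  simp only [zero_ne_one, if_false, add_zero]
  by_cases hb1 : b = 1
  · subst hb1
    rw [if_pos rfl, if_pos]
    have : kdel 1 1 = 1 := by simp [kdel]
    omega
  · have : kdel b 1 = 0 := by simp [kdel, hb1]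
    rw [if_neg hb1, if_neg (by omega)]

lemma A_eq (b : ℕ) (hb : 1 ≤ b) (h : (b + a + kdel a 1) % 2 = 0) (i : Fin (p-1)) :
    Avec p 0 a b i = (ev b i.val : ℚ) := by
  unfold Avec
  rw [ptil_eq b hb h]
  unfold evec ev
  by_cases hb1 : b = 1
  · subst hb1; simp
  · simp [hb1, show 1 < b by omega]

lemma u_eq (b : ℕ) (hb : 1 ≤ b) (h : (b + a + kdel a 1) % 2 = 0) (i : Fin (p-1)) (hi : i.val ≠ 0) :
    uvec p 0 a b i = (ev b i.val : ℚ) + (srcv a i.val : ℚ) := by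
  unfold uvec
  rw [ptil_eq b hb h]
  unfold evec ev srcv
  by_cases hb1 : b = 1
  · subst hb1
    by_cases ha : 1 < a
    · simp [hi, ha, add_comm]
    · simp [hi, ha]
  · by_cases ha : 1 < a
    · simp [hb1, show 1 < b by omega, ha, add_comm]
    · simp [hb1, show 1 < b by omega, ha]

lemma winf_ext (h0 : 0 < r) (hp : 4 ≤ p) (ha : a ≤ p - 2) (b : ℕ) (hb : 1 ≤ b)
    (h : (b + a + kdel a 1) % 2 = 0) (m : Fin (p-1) → ℕ) (hz : 0 < p - 1) :
    winf r p a b (extm p m) =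
      if mlast p m % 2 = (if b = p - 1 then 1 else 0) then
        (r^2) ^ ((PhiQ p (Avec p 0 a b) m : ℝ)) * (1 / qPoch (r^2) (m ⟨0, hz⟩))
          * ∏ i ∈ Finset.univ.filter (fun i : Fin (p - 1) => i.val ≠ 0),
              qBinQ (r^2) ((∑ j, ItM p i j * (m j : ℚ)) / 2 + uvec p 0 a b i / 2) (m i)
      else 0 := by
  unfold winf
  rw [if_pos (fun k hk => extm_ge m k (by omega))]
  have e0 : extm p m 0 = m ⟨0, hz⟩ := extm_fin m ⟨0, hz⟩
  have e1 : (r^2) ^ ((PhiQ p (Avec p 0 a b) m : ℝ)) = r ^ (Qf p (vE 0 b) (extm p m)) := by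
    rw [Phi_eq hp b _ hb (A_eq b hb h), ← Real.rpow_intCast, ← Real.rpow_natCast,
      ← Real.rpow_mul h0.le]
    congr 1
    push_cast; ring
  have e2 : ∏ i ∈ Finset.univ.filter (fun i : Fin (p - 1) => i.val ≠ 0),
        qBinQ (r^2) ((∑ j, ItM p i j * (m j : ℚ)) / 2 + uvec p 0 a b i / 2) (m i)
      = ∏ i ∈ Ico 1 (p-1), fac r p i (topv a (vE 0 b) (extm p m) i) (extm p m i) := by
    have s1 : ∏ i ∈ Finset.univ.filter (fun i : Fin (p - 1) => i.val ≠ 0),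
        qBinQ (r^2) ((∑ j, ItM p i j * (m j : ℚ)) / 2 + uvec p 0 a b i / 2) (m i)
      = ∏ i ∈ Finset.univ.filter (fun i : Fin (p - 1) => i.val ≠ 0),
        fac r p i.val (topv a (vE 0 b) (extm p m) i.val) (extm p m i.val) := by
      refine prod_congr rfl fun i hi => ?_
      have hi0 : i.val ≠ 0 := (mem_filter.1 hi).2
      rw [extm_fin]
      unfold fac
      rw [if_neg (by have := i.2; omega)]
      apply qBin_eq
      rw [row_fin, u_eq b hb h i hi0]
      unfold topv vE
      push_cast; ring
    rw [s1, prod_filter, Fin.prod_univ_eq_prod_range (fun i => if i ≠ 0 then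
      fac r p i (topv a (vE 0 b) (extm p m) i) (extm p m i) else 1),
      prod_range_eq_mul_Ico _ hz]
    simp only [ne_eq, not_true_eq_false, if_false, one_mul]
    refine prod_congr rfl fun i hi => ?_
    rw [if_pos]
    have := (mem_Ico.1 hi).1; omega
  have e3 : Rp r p a b (extm p m) =
      (∏ i ∈ Ico 1 (p-1), fac r p i (topv a (vE 0 b) (extm p m) i) (extm p m i)) *
      fac r p (p-1) (topv a (vE 0 b) (extm p m) (p-1)) (extm p m (p-1)) := by
    unfold Rp
    rw [← prod_Ico_succ_top (by omega), show p - 1 + 1 = p by omega]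
  have e4 : fac r p (p-1) (topv a (vE 0 b) (extm p m) (p-1)) (extm p m (p-1)) =
      if mlast p m % 2 = (if b = p - 1 then 1 else 0) then 1 else 0 := by
    unfold fac
    rw [if_pos rfl, extm_ge m (p-1) le_rfl]
    have l : mlast p m = extm p m (p-2) := by
      unfold mlast extm
      rw [dif_pos (by omega), dif_pos (by omega)]
    have t : topv a (vE 0 b) (extm p m) (p-1) = (mlast p m : ℤ) + if b = p - 1 then 1 else 0 := by
      unfold topv nb
      rw [if_neg (by omega), if_neg (by omega), if_neg (by omega), l,
        show p - 1 - 1 = p - 2 by omega, extm_ge m (p-1+1) (by omega)]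
      have s : srcv a (p-1) = 0 := by unfold srcv; rw [if_neg (by omega)]
      rw [s]
      unfold vE ev
      simp only [eq_comm]
      simp
    rw [t]
    congr 1
    simp only [true_and, eq_iff_iff]
    rw [Int.even_iff]
    split_ifs <;> omega
  rw [e0, e1, e2, e3, e4]
  split_ifs <;> simp

lemma winf_supp (hp : 4 ≤ p) (b : ℕ) (M : ℕ → ℕ) (hM : M ∉ Set.range (extm p)) :
    winf r p a b M = 0 := by
  by_contra hc
  apply hM
  unfold winf at hc
  by_cases h : ∀ k, p ≤ k → M k = 0
  · rw [if_pos h] at hc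
    have hl : M (p-1) = 0 := by
      by_contra hl
      apply hc
      have : Rp r p a b M = 0 := by
        apply prod_eq_zero (i := p-1) (mem_Ico.2 (by omega))
        unfold fac
        rw [if_pos rfl, if_neg (by tauto)]
      rw [this, mul_zero]
    refine ⟨fun i => M i.val, ?_⟩
    funext k
    unfold extm
    split_ifs with hk
    · rfl
    · rcases Nat.lt_or_ge k p with h2 | h2
      · rw [show k = p - 1 by omega, hl]
      · rw [h k h2]
  · rw [if_neg h] at hc
    exact (hc rfl).elim
end

/-- Character identity (even case): for `p ≥ 4`, `1 ≤ a ≤ p-2`, `1 ≤ b ≤ p-1` with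
`b + a + δ_{a,1}` even, and `0 < q < 1`,
`Fer^{p,0}_{a,b}(q) = q^{φ(a,b)} χ^{p,p+1}_{a,b+1}(q)`, where
`Fer^{p,0}_{a,b}(q) = Σ_m q^{(m·C̃m)/4 - (A⁰_{a,b}·m)/2} (1/(q)_{m_0})
  ∏_{j=1}^{p-2} [(½Ĩm + ½u⁰_{a,b})_j choose m_j]_q`,
the sum over all `m ∈ ℤ^{p-1}_{≥0}` with `m_{p-2} ≡ d (mod 2)`, where `d = 0`
if `b ≠ p-1` and `d = 1` if `b = p-1`; both sides converge absolutely. -/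
theorem character_identity_even (p a b : ℕ) (hp : 4 ≤ p) (ha1 : 1 ≤ a) (ha2 : a ≤ p - 2)
    (hb1 : 1 ≤ b) (hb2 : b ≤ p - 1) (hpar : (b + a + kdel a 1) % 2 = 0)
    (q : ℝ) (hq0 : 0 < q) (hq1 : q < 1) :
    Summable (fun m : Fin (p - 1) → ℕ =>
      if mlast p m % 2 = (if b = p - 1 then 1 else 0) then
        q ^ ((PhiQ p (Avec p 0 a b) m : ℝ)) * (1 / qPoch q (m ⟨0, by omega⟩))
          * ∏ i ∈ Finset.univ.filter (fun i : Fin (p - 1) => i.val ≠ 0),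
              qBinQ q ((∑ j, ItM p i j * (m j : ℚ)) / 2 + uvec p 0 a b i / 2) (m i)
      else 0) ∧
    Summable (fun j : ℤ =>
      q ^ ((p : ℤ) * ((p : ℤ) + 1) * j ^ 2 + j * (((p : ℤ) + 1) * a - (p : ℤ) * ((b : ℤ) + 1)))
        - q ^ (((p : ℤ) * j + a) * (((p : ℤ) + 1) * j + ((b : ℤ) + 1)))) ∧
    (∑' m : Fin (p - 1) → ℕ,
      if mlast p m % 2 = (if b = p - 1 then 1 else 0) then
        q ^ ((PhiQ p (Avec p 0 a b) m : ℝ)) * (1 / qPoch q (m ⟨0, by omega⟩))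
          * ∏ i ∈ Finset.univ.filter (fun i : Fin (p - 1) => i.val ≠ 0),
              qBinQ q ((∑ j, ItM p i j * (m j : ℚ)) / 2 + uvec p 0 a b i / 2) (m i)
      else 0)
      = q ^ (phiR (a : ℝ) (b : ℝ)) * chiV p a ((b : ℤ) + 1) q := by
  obtain ⟨r, hr0, hrq⟩ : ∃ r : ℝ, 0 < r ∧ r^2 = q :=
    ⟨Real.sqrt q, Real.sqrt_pos.2 hq0, Real.sq_sqrt hq0.le⟩
  have hr1 : r < 1 := by nlinarith
  subst hrq
  have par : b % 2 = ap a % 2 := by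
    have : kdel a 1 = if a = 1 then 1 else 0 := rfl
    unfold ap
    rw [this] at hpar
    omega
  have hs := main_sum hr0 hr1 hp ha1 ha2 b hb1 hb2 par
  have hs2 := (extm_inj.hasSum_iff (winf_supp hp b)).2 hs
  have e : r^(tri ((b:ℤ)-a)) = (r^2) ^ (phiR (a : ℝ) (b : ℝ)) := by
    rw [← Real.rpow_natCast, ← Real.rpow_mul hr0.le, ← Real.rpow_intCast]
    congr 1
    have := tri_mul ((b:ℤ)-a)
    have t2 : 2 * (tri ((b:ℤ)-a) : ℝ) = ((b:ℝ)-a) * ((b:ℝ)-a+1) := by exact_mod_cast this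
    unfold phiR
    push_cast
    linarith
  rw [e] at hs2
  have hs3 := hs_congr hs2
    (fun m => (winf_ext (a := a) hr0 hp ha2 b hb1 hpar m (by omega)).symm) rfl
  refine ⟨hs3.summable, ?_, hs3.tsum_eq⟩
  have s1 := exE_summ hq0 hq1 p a b (by omega)
  have s2 := exE'_summ hq0 hq1 p a b (by omega)
  exact s1.sub s2
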